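/- arXiv:2510.02216 — 4 statements merged into one kernel-verified Lean document; each statement's English description precedes it below -/
import Mathlib

section
/- Fix t > 0, v ∈ ℝ^(d|I_miss|) and μ_c ∈ ℝ^(d|I_miss|). Let A = α_t²Σ_cond + σ_t²I, κ_t = κ(A), η = 2/(λ_min(A) + λ_max(A)), and s* = −A^(−1)(v − α_t μ_c). Let ε > 0 and let ξ^(0), ξ^(1), … be vectors with ‖ξ^(k)‖₂ ≤ ε for all k. Define the perturbed gradient-descent iterates s^(0) = 0 and s^(k+1) = s^(k) − η(A s^(k) + v − α_t μ_c) + ξ^(k). Then for every integer K ≥ 0: ‖s^(K) − s*‖₂ ≤ exp(−2K/(κ_t+1))·‖s*‖₂ + ((κ_t+1)/2)·ε. In particular, if ‖s*‖₂ > 0 and K ≥ ((κ_t+1)/2)·log(2‖s*‖₂/ε), then ‖s^(K) − s*‖₂ ≤ (κ_t/2 + 1)·ε. -/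
open Matrix
open scoped Kronecker BigOperators

noncomputable section

/-- Euclidean norm of a finitely-indexed real vector. -/
def norm2 {ι : Type*} [Fintype ι] (v : ι → ℝ) : ℝ := Real.sqrt (∑ i, v i ^ 2)

/-- Largest eigenvalue of a real matrix, expressed as the supremum of the Rayleigh
quotient over the Euclidean unit sphere. -/
def lamMax {ι : Type*} [Fintype ι] (A : Matrix ι ι ℝ) : ℝ :=
  ⨆ v : {v : ι → ℝ // ∑ i, v i ^ 2 = 1}, v.1 ⬝ᵥ (A *ᵥ v.1)

/-- Smallest eigenvalue of a real matrix, expressed as the infimum of the Rayleigh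
quotient over the Euclidean unit sphere. -/
def lamMin {ι : Type*} [Fintype ι] (A : Matrix ι ι ℝ) : ℝ :=
  ⨅ v : {v : ι → ℝ // ∑ i, v i ^ 2 = 1}, v.1 ⬝ᵥ (A *ᵥ v.1)

/-- Condition number of a matrix. -/
def kappa {ι : Type*} [Fintype ι] (A : Matrix ι ι ℝ) : ℝ := lamMax A / lamMin A

theorem norm2_eq {ι : Type*} [Fintype ι] (v : ι → ℝ) : norm2 v = ‖WithLp.toLp 2 v‖ := by
  simp [norm2, EuclideanSpace.norm_eq]

theorem norm2_add_le {ι : Type*} [Fintype ι] (v w : ι → ℝ) :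
    norm2 (v + w) ≤ norm2 v + norm2 w := by
  simp only [norm2_eq, WithLp.toLp_add]
  exact norm_add_le _ _

theorem norm2_neg {ι : Type*} [Fintype ι] (v : ι → ℝ) : norm2 (-v) = norm2 v := by
  simp [norm2]

theorem norm2_nonneg {ι : Type*} [Fintype ι] (v : ι → ℝ) : 0 ≤ norm2 v := Real.sqrt_nonneg _

theorem sum_sq_eq_dot {ι : Type*} [Fintype ι] (v : ι → ℝ) : ∑ i, v i ^ 2 = v ⬝ᵥ v := by
  simp [dotProduct, sq]

theorem norm2_sq {ι : Type*} [Fintype ι] (v : ι → ℝ) : norm2 v ^ 2 = v ⬝ᵥ v := by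
  rw [norm2, Real.sq_sqrt (Finset.sum_nonneg fun i _ => sq_nonneg _), sum_sq_eq_dot]

theorem rayleigh_abs_le {ι : Type*} [Fintype ι] (A : Matrix ι ι ℝ)
    (v : {v : ι → ℝ // ∑ i, v i ^ 2 = 1}) :
    |v.1 ⬝ᵥ (A *ᵥ v.1)| ≤ ∑ i, ∑ j, |A i j| := by
  have h1 : ∀ i, |v.1 i| ≤ 1 := fun i => by
    have : v.1 i ^ 2 ≤ 1 := by
      refine le_of_le_of_eq ?_ v.2
      exact Finset.single_le_sum (f := fun i => v.1 i ^ 2) (fun i _ => sq_nonneg _)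
        (Finset.mem_univ i)
    exact (sq_le_one_iff_abs_le_one _).1 this
  simp only [dotProduct, mulVec, Finset.mul_sum]
  refine (Finset.abs_sum_le_sum_abs _ _).trans (Finset.sum_le_sum fun i _ => ?_)
  refine (Finset.abs_sum_le_sum_abs _ _).trans (Finset.sum_le_sum fun j _ => ?_)
  rw [abs_mul, abs_mul]
  have := h1 i
  have := h1 j
  have h3 : |A i j| * |v.1 j| ≤ |A i j| := mul_le_of_le_one_right (abs_nonneg _) (h1 j)
  exact (mul_le_of_le_one_left (by positivity) (h1 i)).trans h3

theorem rayleigh_scale {ι : Type*} [Fintype ι] (A : Matrix ι ι ℝ) (x : ι → ℝ) (hx : x ≠ 0) :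
    ∃ v : {v : ι → ℝ // ∑ i, v i ^ 2 = 1},
      x ⬝ᵥ (A *ᵥ x) = (v.1 ⬝ᵥ (A *ᵥ v.1)) * (x ⬝ᵥ x) := by
  have h0 : x ⬝ᵥ x ≠ 0 := fun h => hx (dotProduct_self_eq_zero.1 h)
  have hs := norm2_sq x
  have hn : norm2 x ≠ 0 := by
    intro h; rw [h] at hs; apply h0; rw [← hs]; simp
  refine ⟨⟨(norm2 x)⁻¹ • x, ?_⟩, ?_⟩
  · rw [sum_sq_eq_dot, smul_dotProduct, dotProduct_smul, ← hs, smul_eq_mul, smul_eq_mul]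
    field_simp
  · simp only [mulVec_smul, smul_dotProduct, dotProduct_smul, smul_eq_mul, ← hs]
    field_simp

theorem le_lamMax {ι : Type*} [Fintype ι] (A : Matrix ι ι ℝ) (x : ι → ℝ) :
    x ⬝ᵥ (A *ᵥ x) ≤ lamMax A * (x ⬝ᵥ x) := by
  by_cases hx : x = 0
  · simp [hx]
  obtain ⟨w, hw⟩ := rayleigh_scale A x hx
  rw [hw]
  refine mul_le_mul_of_nonneg_right ?_ (by rw [← norm2_sq]; positivity)
  refine le_ciSup (f := fun v : {v : ι → ℝ // ∑ i, v i ^ 2 = 1} => v.1 ⬝ᵥ (A *ᵥ v.1)) ?_ w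
  refine ⟨∑ i, ∑ j, |A i j|, ?_⟩
  rintro _ ⟨u, rfl⟩
  exact (abs_le.1 (rayleigh_abs_le A u)).2

theorem lamMin_le {ι : Type*} [Fintype ι] (A : Matrix ι ι ℝ) (x : ι → ℝ) :
    lamMin A * (x ⬝ᵥ x) ≤ x ⬝ᵥ (A *ᵥ x) := by
  by_cases hx : x = 0
  · simp [hx]
  obtain ⟨w, hw⟩ := rayleigh_scale A x hx
  rw [hw]
  refine mul_le_mul_of_nonneg_right ?_ (by rw [← norm2_sq]; positivity)
  refine ciInf_le (f := fun v : {v : ι → ℝ // ∑ i, v i ^ 2 = 1} => v.1 ⬝ᵥ (A *ᵥ v.1)) ?_ w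
  refine ⟨-∑ i, ∑ j, |A i j|, ?_⟩
  rintro _ ⟨u, rfl⟩
  exact (abs_le.1 (rayleigh_abs_le A u)).1

theorem le_lamMin {ι : Type*} [Fintype ι] [Nonempty ι] (A : Matrix ι ι ℝ) (c : ℝ)
    (h : ∀ x : ι → ℝ, c * (x ⬝ᵥ x) ≤ x ⬝ᵥ (A *ᵥ x)) : c ≤ lamMin A := by
  classical
  obtain ⟨i⟩ := ‹Nonempty ι›
  have : Nonempty {v : ι → ℝ // ∑ i, v i ^ 2 = 1} :=
    ⟨⟨Pi.single i 1, by rw [sum_sq_eq_dot]; simp⟩⟩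
  refine le_ciInf fun w => ?_
  have := h w.1
  rwa [← sum_sq_eq_dot, w.2, mul_one] at this

theorem lamMin_le_lamMax {ι : Type*} [Fintype ι] [Nonempty ι] (A : Matrix ι ι ℝ) :
    lamMin A ≤ lamMax A := by
  classical
  obtain ⟨i⟩ := ‹Nonempty ι›
  have h1 := lamMin_le A (Pi.single i 1)
  have h2 := le_lamMax A (Pi.single i 1)
  have h3 : (Pi.single i 1 : ι → ℝ) ⬝ᵥ Pi.single i 1 = 1 := by simp
  rw [h3] at h1 h2
  linarith

theorem dot_symm {ι : Type*} [Fintype ι] (A : Matrix ι ι ℝ) (hA : Aᵀ = A) (x y : ι → ℝ) :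
    x ⬝ᵥ (A *ᵥ y) = (A *ᵥ x) ⬝ᵥ y := by
  rw [dotProduct_mulVec, ← mulVec_transpose, hA]

theorem psd_bound {ι : Type*} [Fintype ι] (P : Matrix ι ι ℝ) (hP : Pᵀ = P) (c : ℝ) (hc : 0 ≤ c)
    (h0 : ∀ x : ι → ℝ, 0 ≤ x ⬝ᵥ (P *ᵥ x)) (h1 : ∀ x : ι → ℝ, x ⬝ᵥ (P *ᵥ x) ≤ c * (x ⬝ᵥ x))
    (x : ι → ℝ) : (P *ᵥ x) ⬝ᵥ (P *ᵥ x) ≤ c * (x ⬝ᵥ (P *ᵥ x)) := by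
  set y := P *ᵥ x with hy
  have key : ∀ r : ℝ, 0 ≤ x ⬝ᵥ y - 2 * r * (y ⬝ᵥ y) + r ^ 2 * (c * (y ⬝ᵥ y)) := by
    intro r
    have h := h0 (x - r • y)
    have e : (x - r • y) ⬝ᵥ (P *ᵥ (x - r • y)) =
        x ⬝ᵥ y - 2 * r * (y ⬝ᵥ y) + r ^ 2 * (y ⬝ᵥ (P *ᵥ y)) := by
      have e2 : x ⬝ᵥ (P *ᵥ y) = y ⬝ᵥ y := dot_symm P hP x y
      simp only [mulVec_sub, mulVec_smul, sub_dotProduct, dotProduct_sub, smul_dotProduct,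
        dotProduct_smul, smul_eq_mul, ← hy, e2]
      ring
    rw [e] at h
    nlinarith [mul_le_mul_of_nonneg_left (h1 y) (sq_nonneg r)]
  rcases hc.eq_or_lt with rfl | hc
  · have := key 1
    have := h1 x
    rw [← hy] at this
    linarith
  · have h := mul_nonneg hc.le (key (1 / c))
    have e : c * (x ⬝ᵥ y - 2 * (1 / c) * (y ⬝ᵥ y) + (1 / c) ^ 2 * (c * (y ⬝ᵥ y)))
        = c * (x ⬝ᵥ y) - y ⬝ᵥ y := by field_simp; ring
    linarith

theorem gd_contract {ι : Type*} [Fintype ι] [DecidableEq ι] [Nonempty ι] (A : Matrix ι ι ℝ)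
    (hA : Aᵀ = A) (hm : 0 < lamMin A) (x : ι → ℝ) :
    norm2 (x - (2 / (lamMin A + lamMax A)) • (A *ᵥ x)) ≤
      (1 - 2 / (kappa A + 1)) * norm2 x := by
  have hmM := lamMin_le_lamMax A
  have hl := lamMin_le A
  have hu := le_lamMax A
  have hk : 1 - 2 / (kappa A + 1) = (lamMax A - lamMin A) / (lamMin A + lamMax A) := by
    rw [kappa]
    have : lamMin A + lamMax A ≠ 0 := by linarith
    have : lamMax A + lamMin A ≠ 0 := by linarith
    field_simp
    ring
  rw [hk]
  generalize lamMin A = m at *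
  generalize lamMax A = M at *
  have hP := psd_bound (A - m • 1) (by simp [hA]) (M - m) (by linarith)
    (fun x => by
      simp only [sub_mulVec, smul_mulVec, one_mulVec, dotProduct_sub, dotProduct_smul, smul_eq_mul]
      linarith [hl x])
    (fun x => by
      simp only [sub_mulVec, smul_mulVec, one_mulVec, dotProduct_sub, dotProduct_smul, smul_eq_mul]
      linarith [hu x]) x
  simp only [sub_mulVec, smul_mulVec, one_mulVec, dotProduct_sub, sub_dotProduct, smul_dotProduct,
    dotProduct_smul, smul_eq_mul] at hP
  rw [dotProduct_comm (A *ᵥ x) x] at hP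
  have hS : 0 < m + M := by linarith
  refine abs_le_of_sq_le_sq' ?_ (mul_nonneg (div_nonneg (by linarith) hS.le) (norm2_nonneg _)) |>.2
  rw [mul_pow, norm2_sq, norm2_sq]
  simp only [dotProduct_sub, sub_dotProduct, smul_dotProduct, dotProduct_smul, smul_eq_mul]
  rw [dotProduct_comm (A *ᵥ x) x]
  have h2 : (A *ᵥ x) ⬝ᵥ (A *ᵥ x) ≤ (m + M) * (x ⬝ᵥ (A *ᵥ x)) - m * M * (x ⬝ᵥ x) := by linarith
  generalize (A *ᵥ x) ⬝ᵥ (A *ᵥ x) = p at *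
  generalize x ⬝ᵥ (A *ᵥ x) = a at *
  generalize x ⬝ᵥ x = n at *
  have h3 : 0 ≤ (2 / (m + M)) ^ 2 * ((m + M) * a - m * M * n - p) :=
    mul_nonneg (sq_nonneg _) (by linarith)
  have e : ((M - m) / (m + M)) ^ 2 * n - (n - 2 / (m + M) * a - 2 / (m + M) * (a - 2 / (m + M) * p))
      = (2 / (m + M)) ^ 2 * ((m + M) * a - m * M * n - p) := by
    field_simp; ring
  linarith

theorem gd_main {ι : Type*} [Fintype ι] [DecidableEq ι] [Nonempty ι] (A : Matrix ι ι ℝ)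
    (hA : A.PosDef) (hm : 0 < lamMin A) (b : ι → ℝ) (ε : ℝ) (hε : 0 < ε) (ξ s : ℕ → ι → ℝ)
    (hξ : ∀ k, norm2 (ξ k) ≤ ε) (h0 : s 0 = 0)
    (hs : ∀ k, s (k + 1) = s k - (2 / (lamMin A + lamMax A)) • (A *ᵥ s k + b) + ξ k) :
    (∀ K : ℕ,
      norm2 (s K - -(A⁻¹ *ᵥ b)) ≤
        Real.exp (-2 * (K : ℝ) / (kappa A + 1)) * norm2 (-(A⁻¹ *ᵥ b)) +
          ((kappa A + 1) / 2) * ε) ∧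
    (0 < norm2 (-(A⁻¹ *ᵥ b)) → ∀ K : ℕ,
      ((kappa A + 1) / 2) * Real.log (2 * norm2 (-(A⁻¹ *ᵥ b)) / ε) ≤ (K : ℝ) →
      norm2 (s K - -(A⁻¹ *ᵥ b)) ≤ (kappa A / 2 + 1) * ε) := by
  have hT : Aᵀ = A := by simpa using hA.isHermitian.eq
  have hc := gd_contract A hT hm
  have hk : 1 ≤ kappa A := by
    rw [kappa, le_div_iff₀ hm, one_mul]; exact lamMin_le_lamMax A
  have hAs : A *ᵥ (-(A⁻¹ *ᵥ b)) = -b := by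
    rw [mulVec_neg, mulVec_mulVec, mul_nonsing_inv A ((isUnit_iff_isUnit_det A).1 hA.isUnit), one_mulVec]
  generalize -(A⁻¹ *ᵥ b) = z at *
  generalize kappa A = κ at *
  have hκ : 0 < κ + 1 := by linarith
  have first : ∀ K : ℕ, norm2 (s K - z) ≤
      Real.exp (-2 * (K : ℝ) / (κ + 1)) * norm2 z + ((κ + 1) / 2) * ε := by
    intro K
    induction K with
    | zero =>
      have : 0 ≤ (κ + 1) / 2 * ε := by positivity
      simpa [h0, norm2_neg] using this
    | succ K ih =>
      have e : s (K + 1) - z =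
          ((s K - z) - (2 / (lamMin A + lamMax A)) • (A *ᵥ (s K - z))) + ξ K := by
        rw [hs, mulVec_sub, hAs, sub_neg_eq_add]; abel
      have hr : 0 ≤ 1 - 2 / (κ + 1) := by
        rw [sub_nonneg, div_le_one hκ]; linarith
      have hexp : 1 - 2 / (κ + 1) ≤ Real.exp (-2 / (κ + 1)) := by
        have := Real.add_one_le_exp (-2 / (κ + 1))
        rw [neg_div] at *
        linarith
      have hsplit : Real.exp (-2 * ((K + 1 : ℕ) : ℝ) / (κ + 1)) =
          Real.exp (-2 / (κ + 1)) * Real.exp (-2 * (K : ℝ) / (κ + 1)) := by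
        rw [← Real.exp_add]; congr 1; push_cast; ring
      have hz := norm2_nonneg z
      calc norm2 (s (K + 1) - z) ≤ (1 - 2 / (κ + 1)) * norm2 (s K - z) + ε := by
            rw [e]; exact (norm2_add_le _ _).trans (add_le_add (hc _) (hξ K))
        _ ≤ (1 - 2 / (κ + 1)) *
            (Real.exp (-2 * (K : ℝ) / (κ + 1)) * norm2 z + ((κ + 1) / 2) * ε) + ε := by gcongr
        _ = (1 - 2 / (κ + 1)) * (Real.exp (-2 * (K : ℝ) / (κ + 1)) * norm2 z) +
            ((κ + 1) / 2) * ε := by field_simp; ring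
        _ ≤ Real.exp (-2 / (κ + 1)) * (Real.exp (-2 * (K : ℝ) / (κ + 1)) * norm2 z) +
            ((κ + 1) / 2) * ε := by gcongr
        _ = _ := by rw [hsplit]; ring
  refine ⟨first, fun hz K hK => (first K).trans ?_⟩
  have h1 : -2 * (K : ℝ) / (κ + 1) ≤ -Real.log (2 * norm2 z / ε) := by
    rw [div_le_iff₀ hκ]; linarith
  have h2 : Real.exp (-2 * (K : ℝ) / (κ + 1)) ≤ (2 * norm2 z / ε)⁻¹ := by
    refine (Real.exp_le_exp.2 h1).trans_eq ?_
    rw [Real.exp_neg, Real.exp_log (by positivity)]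
  have h3 := mul_le_mul_of_nonneg_right h2 hz.le
  have h4 : (2 * norm2 z / ε)⁻¹ * norm2 z = ε / 2 := by field_simp
  linarith

theorem schur_psd {H d : ℕ} (Γ : Matrix (Fin H) (Fin H) ℝ) (Λ : Matrix (Fin d) (Fin d) ℝ)
    (hΓ : Γ.PosDef) (hΛ : Λ.PosDef) (Iobs Imiss : Finset (Fin H)) :
    ((Γ.submatrix (fun i : {i // i ∈ Imiss} => (i : Fin H)) (fun i : {i // i ∈ Imiss} => (i : Fin H))) ⊗ₖ Λ
      - ((Γ.submatrix (fun i : {i // i ∈ Iobs} => (i : Fin H)) (fun i : {i // i ∈ Imiss} => (i : Fin H))) ⊗ₖ Λ).transpose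
        * ((Γ.submatrix (fun i : {i // i ∈ Iobs} => (i : Fin H)) (fun i : {i // i ∈ Iobs} => (i : Fin H))) ⊗ₖ Λ)⁻¹
        * ((Γ.submatrix (fun i : {i // i ∈ Iobs} => (i : Fin H)) (fun i : {i // i ∈ Imiss} => (i : Fin H))) ⊗ₖ Λ)).PosSemidef := by
  have hobs : ((Γ.submatrix (fun i : {i // i ∈ Iobs} => (i : Fin H))
      (fun i : {i // i ∈ Iobs} => (i : Fin H))) ⊗ₖ Λ).PosDef :=
    (hΓ.submatrix Subtype.val_injective).kronecker hΛ
  have := hobs.isUnit.invertible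
  rw [← conjTranspose_eq_transpose_of_trivial, ← PosDef.fromBlocks₁₁ _ _ hobs]
  have h := (hΓ.kronecker hΛ).posSemidef.submatrix
    (Sum.elim (fun p : {i // i ∈ Iobs} × Fin d => ((p.1 : Fin H), p.2))
      (fun p : {i // i ∈ Imiss} × Fin d => ((p.1 : Fin H), p.2)))
  refine Eq.subst (motive := Matrix.PosSemidef) ?_ h
  have hs : ∀ i j, Γ i j = Γ j i := fun i j => by
    simpa using (hΓ.isHermitian.apply i j).symm
  have hs' : ∀ i j, Λ i j = Λ j i := fun i j => by
    simpa using (hΛ.isHermitian.apply i j).symm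
  ext (i | i) (j | j)
  · simp
  · simp
  · simp [hs j.1 i.1, hs' j.2 i.2]
  · simp


/-- perturbed gradient descent on the strongly convex quadratic
`L_t(s) = (1/2)sᵀAs + sᵀ(v − α_t μ_c)` with `A = α_t²Σ_cond + σ_t²I`,
step size `η = 2/(λ_min(A) + λ_max(A))` and per-step errors of norm at most `ε`:
for every `K`, `‖s^(K) − s*‖₂ ≤ exp(−2K/(κ_t+1))‖s*‖₂ + ((κ_t+1)/2)ε`, and if
`‖s*‖₂ > 0` and `K ≥ ((κ_t+1)/2)·log(2‖s*‖₂/ε)` then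
`‖s^(K) − s*‖₂ ≤ (κ_t/2 + 1)ε`. -/
theorem gd_major_perturbed_convergence
    {H d : ℕ} (hH : 2 ≤ H) (hd : 1 ≤ d)
    (Γ : Matrix (Fin H) (Fin H) ℝ) (Λ : Matrix (Fin d) (Fin d) ℝ)
    (hΓ : Γ.PosDef) (hΛ : Λ.PosDef)
    (Iobs Imiss : Finset (Fin H)) (hobs : Iobs.Nonempty) (hmiss : Imiss.Nonempty)
    (hdisj : Disjoint Iobs Imiss) (hunion : Iobs ∪ Imiss = Finset.univ)
    (t : ℝ) (ht : 0 < t)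
    (v μc : {i // i ∈ Imiss} × Fin d → ℝ)
    (ε : ℝ) (hε : 0 < ε)
    (ξ s : ℕ → ({i // i ∈ Imiss} × Fin d → ℝ)) :
    let Γobs : Matrix {i // i ∈ Iobs} {i // i ∈ Iobs} ℝ :=
      Γ.submatrix (fun i => (i : Fin H)) (fun i => (i : Fin H))
    let Γmiss : Matrix {i // i ∈ Imiss} {i // i ∈ Imiss} ℝ :=
      Γ.submatrix (fun i => (i : Fin H)) (fun i => (i : Fin H))
    let Γcor : Matrix {i // i ∈ Iobs} {i // i ∈ Imiss} ℝ :=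
      Γ.submatrix (fun i => (i : Fin H)) (fun i => (i : Fin H))
    let Sobs : Matrix ({i // i ∈ Iobs} × Fin d) ({i // i ∈ Iobs} × Fin d) ℝ := Γobs ⊗ₖ Λ
    let Smiss : Matrix ({i // i ∈ Imiss} × Fin d) ({i // i ∈ Imiss} × Fin d) ℝ := Γmiss ⊗ₖ Λ
    let Scor : Matrix ({i // i ∈ Iobs} × Fin d) ({i // i ∈ Imiss} × Fin d) ℝ := Γcor ⊗ₖ Λ
    let Scond : Matrix ({i // i ∈ Imiss} × Fin d) ({i // i ∈ Imiss} × Fin d) ℝ :=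
      Smiss - Scor.transpose * Sobs⁻¹ * Scor
    let αt : ℝ := Real.exp (-t/2)
    let σt : ℝ := Real.sqrt (1 - Real.exp (-t))
    let A : Matrix ({i // i ∈ Imiss} × Fin d) ({i // i ∈ Imiss} × Fin d) ℝ :=
      αt^2 • Scond + σt^2 • (1 : Matrix ({i // i ∈ Imiss} × Fin d) ({i // i ∈ Imiss} × Fin d) ℝ)
    let κt : ℝ := kappa A
    let η : ℝ := 2 / (lamMin A + lamMax A)
    let sstar : {i // i ∈ Imiss} × Fin d → ℝ := -(A⁻¹ *ᵥ (v - αt • μc))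
    (∀ k : ℕ, norm2 (ξ k) ≤ ε) →
    s 0 = 0 →
    (∀ k : ℕ, s (k + 1) = s k - η • (A *ᵥ s k + (v - αt • μc)) + ξ k) →
    (∀ K : ℕ,
      norm2 (s K - sstar) ≤
        Real.exp (-2 * (K : ℝ) / (κt + 1)) * norm2 sstar + ((κt + 1) / 2) * ε) ∧
    (0 < norm2 sstar → ∀ K : ℕ,
      ((κt + 1) / 2) * Real.log (2 * norm2 sstar / ε) ≤ (K : ℝ) →
      norm2 (s K - sstar) ≤ (κt / 2 + 1) * ε) := by
  intro Γobs Γmiss Γcor Sobs Smiss Scor Scond αt σt A κt η sstar hξ h0 hs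
  have hS : Scond.PosSemidef := schur_psd Γ Λ hΓ hΛ Iobs Imiss
  have hσ : 0 < σt ^ 2 := by
    have : 0 < σt := Real.sqrt_pos.2 (by
      have := Real.exp_lt_one_iff.2 (neg_lt_zero.2 ht)
      linarith)
    positivity
  have : Nonempty ({i // i ∈ Imiss} × Fin d) := by
    obtain ⟨i, hi⟩ := hmiss
    exact ⟨(⟨i, hi⟩, ⟨0, hd⟩)⟩
  have hA : A.PosDef :=
    Matrix.PosDef.posSemidef_add (hS.smul (sq_nonneg αt)) (Matrix.PosDef.one.smul hσ)
  have hm : 0 < lamMin A := by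
    refine hσ.trans_le (le_lamMin A _ fun x => ?_)
    have h1 : 0 ≤ x ⬝ᵥ (Scond *ᵥ x) := by simpa using hS.dotProduct_mulVec_nonneg x
    have e : x ⬝ᵥ (A *ᵥ x) = αt ^ 2 * (x ⬝ᵥ (Scond *ᵥ x)) + σt ^ 2 * (x ⬝ᵥ x) := by
      simp only [A, add_mulVec, smul_mulVec, one_mulVec, dotProduct_add, dotProduct_smul,
        smul_eq_mul]
    rw [e]
    have := mul_nonneg (sq_nonneg αt) h1
    linarith
  exact gd_main A hA hm (v - αt • μc) ε hε ξ s hξ h0 hs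

end
end

section
/- There exists an absolute constant c > 0 with the following property. Fix integers m₁, m₂ ≥ 1, real numbers 0 < t₀ ≤ 1 ≤ T, C > 0, B > 0 and δ_d ∈ (0, 1], and set α_t = e^(−t/2), σ_t = √(1 − e^(−t)). Let (x, y) be a random vector in ℝ^(m₁) × ℝ^(m₂) and z ~ N(0, I_{m₁}) independent of (x, y), and suppose that for every t ∈ [t₀, T], the probability that (‖x‖₂ > C or ‖α_t x + σ_t z‖₂ > C) is at most δ_d. Let s : ℝ^(m₁) × ℝ^(m₂) × ℝ → ℝ^(m₁) be measurable with ‖s(v, y, t)‖₂ ≤ σ_t^(−2)·B for all v, y and all t ∈ [t₀, T]. Define ℓ(x, y; s) = ∫_{t₀}^{T} E_z[‖s(α_t x + σ_t z, y, t) + z/σ_t‖₂²] dt and ℓ^trunc(x, y; s) the same integral with the integrand multiplied by the indicator 1{‖x‖₂ ≤ C and ‖α_t x + σ_t z‖₂ ≤ C}. Then E_{(x,y)}[ |ℓ(x, y; s) − ℓ^trunc(x, y; s)| ] ≤ c·√(δ_d)·(B² + m₁)·(T + 1/t₀). -/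
open Matrix MeasureTheory
open scoped BigOperators

noncomputable section

/-- Density of the multivariate Gaussian `N(μ, Σ)` with respect to Lebesgue measure. -/
def gaussDensity {ι : Type*} [Fintype ι] [DecidableEq ι]
    (μ : ι → ℝ) (S : Matrix ι ι ℝ) (x : ι → ℝ) : ℝ :=
  (Real.sqrt ((2 * Real.pi) ^ (Fintype.card ι) * S.det))⁻¹ *
    Real.exp (-((x - μ) ⬝ᵥ (S⁻¹ *ᵥ (x - μ))) / 2)

/-- The multivariate Gaussian measure `N(μ, Σ)` on `ι → ℝ`, defined through its
density with respect to Lebesgue measure. -/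
def gaussMeasure {ι : Type*} [Fintype ι] [DecidableEq ι]
    (μ : ι → ℝ) (S : Matrix ι ι ℝ) : Measure (ι → ℝ) :=
  volume.withDensity (fun x => ENNReal.ofReal (gaussDensity μ S x))

/-- `α_t = e^{-t/2}` for the forward Ornstein–Uhlenbeck process. -/
def OUalpha (t : ℝ) : ℝ := Real.exp (-t/2)

/-- `σ_t = √(1 − e^{-t})` for the forward Ornstein–Uhlenbeck process. -/
def OUsigma (t : ℝ) : ℝ := Real.sqrt (1 - Real.exp (-t))

/-- The denoising score-matching loss
`ℓ(x, y; s) = ∫_{t₀}^{T} E_{z ~ N(0,I)}[‖s(α_t x + σ_t z, y, t) + z/σ_t‖₂²] dt`. -/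
def lfull (m₁ m₂ : ℕ) (t₀ T : ℝ)
    (s : (Fin m₁ → ℝ) → (Fin m₂ → ℝ) → ℝ → (Fin m₁ → ℝ))
    (x : Fin m₁ → ℝ) (y : Fin m₂ → ℝ) : ℝ :=
  ∫ t in t₀..T,
    ∫ z, (norm2 (s (OUalpha t • x + OUsigma t • z) y t + (OUsigma t)⁻¹ • z)) ^ 2
      ∂(gaussMeasure (0 : Fin m₁ → ℝ) (1 : Matrix (Fin m₁) (Fin m₁) ℝ))

/-- The truncated denoising score-matching loss: same as `lfull` with the integrand
multiplied by the indicator `1{‖x‖₂ ≤ C, ‖α_t x + σ_t z‖₂ ≤ C}`. -/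
def ltrunc (m₁ m₂ : ℕ) (t₀ T C : ℝ)
    (s : (Fin m₁ → ℝ) → (Fin m₂ → ℝ) → ℝ → (Fin m₁ → ℝ))
    (x : Fin m₁ → ℝ) (y : Fin m₂ → ℝ) : ℝ :=
  ∫ t in t₀..T,
    ∫ z, Set.indicator
        {z' : Fin m₁ → ℝ | norm2 x ≤ C ∧ norm2 (OUalpha t • x + OUsigma t • z') ≤ C}
        (fun z' =>
          (norm2 (s (OUalpha t • x + OUsigma t • z') y t + (OUsigma t)⁻¹ • z')) ^ 2) z
      ∂(gaussMeasure (0 : Fin m₁ → ℝ) (1 : Matrix (Fin m₁) (Fin m₁) ℝ))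

open ProbabilityTheory in
lemma gauss_eq_pi (m : ℕ) : gaussMeasure (0 : Fin m → ℝ) (1 : Matrix (Fin m) (Fin m) ℝ) =
    Measure.pi (fun _ : Fin m => gaussianReal 0 1) := by
  symm
  apply Measure.pi_eq
  intro s hs
  have hd : ∀ x : Fin m → ℝ, gaussDensity (0 : Fin m → ℝ) (1 : Matrix (Fin m) (Fin m) ℝ) x
      = ∏ i, gaussianPDFReal 0 1 (x i) := by
    intro x
    simp only [gaussDensity, gaussianPDFReal, Matrix.det_one, inv_one, Matrix.one_mulVec,
      sub_zero, mul_one, NNReal.coe_one, Finset.prod_mul_distrib, Finset.prod_const,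
      Finset.card_univ, ← Real.exp_sum, Fintype.card_fin]
    congr 1
    · rw [inv_pow]
      congr 1
      rw [Real.sqrt_eq_iff_mul_self_eq (by positivity) (by positivity), ← mul_pow,
        Real.mul_self_sqrt (by positivity)]
    · congr 1
      rw [← Finset.sum_div, Finset.sum_neg_distrib]
      simp [dotProduct, sq]
  have hind : ∀ x : Fin m → ℝ, (Set.univ.pi s).indicator (fun x => ∏ i, gaussianPDFReal 0 1 (x i)) x
      = ∏ i, (s i).indicator (gaussianPDFReal 0 1) (x i) := by
    intro x
    by_cases hx : x ∈ Set.univ.pi s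
    · rw [Set.indicator_of_mem hx]
      refine Finset.prod_congr rfl fun i _ => ?_
      rw [Set.indicator_of_mem (hx i trivial)]
    · rw [Set.indicator_of_notMem hx]
      simp only [Set.mem_univ_pi, not_forall] at hx
      obtain ⟨i, hi⟩ := hx
      symm
      exact Finset.prod_eq_zero (Finset.mem_univ i) (Set.indicator_of_notMem hi _)
  have hms : MeasurableSet (Set.univ.pi s) := MeasurableSet.univ_pi hs
  have hint : ∀ i, Integrable ((s i).indicator (gaussianPDFReal 0 1)) :=
    fun i => (integrable_gaussianPDFReal 0 1).indicator (hs i)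
  rw [gaussMeasure, withDensity_apply _ hms]
  simp_rw [hd]
  have hi2 : Integrable (fun x : Fin m → ℝ => ∏ i, (s i).indicator (gaussianPDFReal 0 1) (x i)) :=
    Integrable.fintype_prod_dep hint
  rw [← ofReal_integral_eq_lintegral_ofReal, ← integral_indicator hms]
  · simp_rw [hind]
    rw [integral_fintype_prod_volume_eq_prod, ENNReal.ofReal_prod_of_nonneg]
    · refine Finset.prod_congr rfl fun i _ => ?_
      rw [gaussianReal_of_var_ne_zero _ one_ne_zero, withDensity_apply _ (hs i),
        integral_indicator (hs i), ofReal_integral_eq_lintegral_ofReal]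
      · rfl
      · exact (integrable_gaussianPDFReal 0 1).integrableOn
      · exact ae_of_all _ fun x => gaussianPDFReal_nonneg _ _ _
    · intro i _
      exact integral_nonneg fun x => Set.indicator_nonneg (fun x _ => gaussianPDFReal_nonneg _ _ _) _
  · rw [← IntegrableOn, ← integrable_indicator_iff hms]
    exact hi2.congr (ae_of_all _ fun x => (hind x).symm)
  · exact ae_of_all _ fun x => Finset.prod_nonneg fun i _ => gaussianPDFReal_nonneg _ _ _

instance gauss_prob (m : ℕ) :
    IsProbabilityMeasure (gaussMeasure (0 : Fin m → ℝ) (1 : Matrix (Fin m) (Fin m) ℝ)) := by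
  rw [gauss_eq_pi]; infer_instance

lemma norm2_sq_s14 {m : ℕ} (z : Fin m → ℝ) : norm2 z ^ 2 = ∑ i, z i ^ 2 :=
  Real.sq_sqrt (Finset.sum_nonneg fun i _ => sq_nonneg _)

lemma norm2_nonneg_s14 {m : ℕ} (z : Fin m → ℝ) : 0 ≤ norm2 z := Real.sqrt_nonneg _

lemma norm2_meas (m : ℕ) : Measurable (norm2 : (Fin m → ℝ) → ℝ) := by
  unfold norm2; fun_prop

def Kfour : ℝ := ∫ x, x ^ 4 ∂(ProbabilityTheory.gaussianReal 0 1)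

lemma Kfour_nonneg : 0 ≤ Kfour := integral_nonneg fun x => by positivity

open ProbabilityTheory in
lemma four_int : Integrable (fun x : ℝ => x ^ 4) (gaussianReal 0 1) := by
  have h := (memLp_id_gaussianReal (μ := 0) (v := 1) 4).integrable_norm_pow (by norm_num)
  refine h.congr (ae_of_all _ fun x => ?_)
  simp only [id, Real.norm_eq_abs]
  exact Even.pow_abs (by decide) x

open ProbabilityTheory in
lemma four_moment (m : ℕ) :
    Integrable (fun z : Fin m → ℝ => norm2 z ^ 4)
      (gaussMeasure (0 : Fin m → ℝ) (1 : Matrix (Fin m) (Fin m) ℝ)) ∧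
    ∫ z, norm2 z ^ 4 ∂(gaussMeasure (0 : Fin m → ℝ) (1 : Matrix (Fin m) (Fin m) ℝ))
      ≤ (m : ℝ) ^ 2 * Kfour := by
  rw [gauss_eq_pi]
  have hmp := fun i : Fin m => measurePreserving_eval (fun _ : Fin m => gaussianReal 0 1) i
  have h1 : ∀ i : Fin m, Integrable (fun z : Fin m → ℝ => z i ^ 4)
      (Measure.pi (fun _ : Fin m => gaussianReal 0 1)) := fun i =>
    (hmp i).integrable_comp_of_integrable four_int
  have h2 : Integrable (fun z : Fin m → ℝ => (m : ℝ) * ∑ i, z i ^ 4)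
      (Measure.pi (fun _ : Fin m => gaussianReal 0 1)) :=
    (integrable_finsetSum _ fun i _ => h1 i).const_mul _
  have h3 : ∀ z : Fin m → ℝ, norm2 z ^ 4 ≤ (m : ℝ) * ∑ i, z i ^ 4 := by
    intro z
    have := sq_sum_le_card_mul_sum_sq (s := (Finset.univ : Finset (Fin m))) (f := fun i => z i ^ 2)
    rw [← norm2_sq_s14] at this
    simp only [← pow_mul, Finset.card_univ, Fintype.card_fin] at this
    exact this
  have h4 : Integrable (fun z : Fin m → ℝ => norm2 z ^ 4)
      (Measure.pi (fun _ : Fin m => gaussianReal 0 1)) := by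
    refine h2.mono' ((norm2_meas m).pow_const 4).aestronglyMeasurable (ae_of_all _ fun z => ?_)
    rw [Real.norm_of_nonneg (by have := norm2_nonneg_s14 z; positivity)]
    exact h3 z
  refine ⟨h4, (integral_mono h4 h2 h3).trans ?_⟩
  rw [integral_const_mul, integral_finsetSum _ fun i _ => h1 i]
  have h5 : ∀ i : Fin m, ∫ z : Fin m → ℝ, z i ^ 4 ∂(Measure.pi (fun _ : Fin m => gaussianReal 0 1))
      = Kfour := by
    intro i
    have := integral_map (μ := Measure.pi (fun _ : Fin m => gaussianReal 0 1))
      (hmp i).measurable.aemeasurable (f := fun x : ℝ => x ^ 4) (by fun_prop)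
    rw [(hmp i).map_eq] at this
    exact this.symm
  simp only [h5, Finset.sum_const, Finset.card_univ, Fintype.card_fin, nsmul_eq_mul]
  apply le_of_eq; ring

def kap (t : ℝ) : ℝ := ((OUsigma t ^ 2)⁻¹) ^ 2

lemma kap_nonneg (t : ℝ) : 0 ≤ kap t := by unfold kap; positivity

lemma OUsigma_meas : Measurable OUsigma := by unfold OUsigma; fun_prop
lemma OUalpha_meas : Measurable OUalpha := by unfold OUalpha; fun_prop
lemma kap_meas : Measurable kap := by
  unfold kap; exact ((OUsigma_meas.pow_const 2).inv).pow_const 2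

lemma OUsigma_sq {t : ℝ} (ht : 0 < t) : OUsigma t ^ 2 = 1 - Real.exp (-t) :=
  Real.sq_sqrt (by have : Real.exp (-t) ≤ 1 := Real.exp_le_one_iff.2 (by linarith)
                   linarith)

lemma sig_inv_le {t : ℝ} (ht : 0 < t) : (OUsigma t ^ 2)⁻¹ ≤ 1 + 1 / t := by
  rw [OUsigma_sq ht, Real.exp_neg]
  have h1 : t + 1 ≤ Real.exp t := Real.add_one_le_exp t
  have h2 : (Real.exp t)⁻¹ ≤ (t + 1)⁻¹ := inv_anti₀ (by linarith) h1
  have h3 : 1 - (t + 1)⁻¹ = (1 + 1 / t)⁻¹ := by field_simp; ring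
  rw [inv_le_comm₀ (by have : (t+1)⁻¹ < 1 := inv_lt_one_of_one_lt₀ (by linarith)
                       linarith) (by positivity), ← h3]
  linarith

lemma one_le_sig_inv {t : ℝ} (ht : 0 < t) : 1 ≤ (OUsigma t ^ 2)⁻¹ := by
  rw [OUsigma_sq ht]
  have h := Real.exp_pos (-t)
  have h2 : Real.exp (-t) < 1 := by simpa using ht
  exact (one_le_inv₀ (by linarith)).2 (by linarith)

lemma kap_le {t : ℝ} (ht : 0 < t) : kap t ≤ 2 + 2 * (t ^ 2)⁻¹ := by
  have h1 := sig_inv_le ht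
  have h2 := one_le_sig_inv ht
  have h3 : kap t ≤ (1 + 1 / t) ^ 2 := by unfold kap; gcongr
  refine h3.trans ?_
  have : (t ^ 2)⁻¹ = (1 / t) ^ 2 := by simp
  rw [this]
  nlinarith [sq_nonneg (1 - 1 / t)]

lemma kap_int {t₀ T : ℝ} (h0 : 0 < t₀) (hT : t₀ ≤ T) :
    IntegrableOn kap (Set.Ioc t₀ T) ∧ ∫ t in Set.Ioc t₀ T, kap t ≤ 2 * (T + 1 / t₀) := by
  have hcont : ContinuousOn (fun t : ℝ => 2 + 2 * (t ^ 2)⁻¹) (Set.uIcc t₀ T) := by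
    rw [Set.uIcc_of_le hT]
    refine continuousOn_const.add (continuousOn_const.mul (ContinuousOn.inv₀ (by fun_prop) ?_))
    intro t ht
    have : 0 < t := h0.trans_le ht.1
    positivity
  have hii := hcont.intervalIntegrable (μ := volume)
  have hi : IntegrableOn (fun t : ℝ => 2 + 2 * (t ^ 2)⁻¹) (Set.Ioc t₀ T) :=
    (intervalIntegrable_iff_integrableOn_Ioc_of_le hT).1 hii
  have hk : IntegrableOn kap (Set.Ioc t₀ T) := by
    refine hi.mono' kap_meas.aestronglyMeasurable ?_
    refine (ae_restrict_mem measurableSet_Ioc).mono fun t ht => ?_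
    rw [Real.norm_of_nonneg (kap_nonneg t)]
    exact kap_le (h0.trans ht.1)
  refine ⟨hk, ?_⟩
  refine (setIntegral_mono_on hk hi measurableSet_Ioc fun t ht => kap_le (h0.trans ht.1)).trans ?_
  rw [← intervalIntegral.integral_of_le hT,
    intervalIntegral.integral_eq_sub_of_hasDerivAt (f := fun t => 2 * t - 2 * t⁻¹) _ hii]
  · have : 0 < T := h0.trans_le hT
    have : 0 < T⁻¹ := by positivity
    simp only [one_div]
    linarith
  · intro t ht
    rw [Set.uIcc_of_le hT] at ht
    have : t ≠ 0 := (h0.trans_le ht.1).ne'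
    convert ((hasDerivAt_id t).const_mul 2).sub ((hasDerivAt_inv this).const_mul 2) using 1
    · rfl
    · ring

lemma H_le {m : ℕ} {t B : ℝ} (ht : 0 < t) (v z : Fin m → ℝ)
    (hv : norm2 v ≤ ((OUsigma t) ^ 2)⁻¹ * B) :
    norm2 (v + (OUsigma t)⁻¹ • z) ^ 2 ≤ 2 * kap t * (B ^ 2 + norm2 z ^ 2) := by
  have h1 : norm2 (v + (OUsigma t)⁻¹ • z) ^ 2 ≤
      2 * norm2 v ^ 2 + 2 * ((OUsigma t ^ 2)⁻¹ * norm2 z ^ 2) := by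
    simp only [norm2_sq_s14, Finset.mul_sum, ← Finset.sum_add_distrib]
    refine Finset.sum_le_sum fun i _ => ?_
    simp only [Pi.add_apply, Pi.smul_apply, smul_eq_mul]
    rw [← inv_pow]
    nlinarith [sq_nonneg (v i - (OUsigma t)⁻¹ * z i)]
  have h2 : norm2 v ^ 2 ≤ kap t * B ^ 2 := by
    have := pow_le_pow_left₀ (norm2_nonneg_s14 v) hv 2
    rwa [mul_pow] at this
  have h3 : (OUsigma t ^ 2)⁻¹ ≤ kap t := by
    have := one_le_sig_inv ht
    unfold kap
    nlinarith
  have h4 := mul_le_mul_of_nonneg_right h3 (sq_nonneg (norm2 z))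
  linarith

lemma badset_meas (m₁ m₂ : ℕ) (C : ℝ) : MeasurableSet
    {r : ((Fin m₁ → ℝ) × (Fin m₂ → ℝ)) × (ℝ × (Fin m₁ → ℝ)) |
      ¬ (norm2 r.1.1 ≤ C ∧ norm2 (OUalpha r.2.1 • r.1.1 + OUsigma r.2.1 • r.2.2) ≤ C)} := by
  have h1 := norm2_meas m₁
  have h2 := OUalpha_meas
  have h3 := OUsigma_meas
  refine MeasurableSet.compl (MeasurableSet.inter ?_ ?_)
  · exact measurableSet_le (h1.comp (by fun_prop)) measurable_const
  · exact measurableSet_le (h1.comp (by fun_prop)) measurable_const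

lemma gap_le (m₁ m₂ : ℕ) (t₀ T C B lam : ℝ) (h0 : 0 < t₀) (hT : t₀ ≤ T) (hlam : 0 < lam)
    (s : (Fin m₁ → ℝ) → (Fin m₂ → ℝ) → ℝ → (Fin m₁ → ℝ))
    (hs : Measurable fun p : (Fin m₁ → ℝ) × (Fin m₂ → ℝ) × ℝ => s p.1 p.2.1 p.2.2)
    (hb : ∀ (v : Fin m₁ → ℝ) (y : Fin m₂ → ℝ) (t : ℝ), t ∈ Set.Icc t₀ T →
        norm2 (s v y t) ≤ ((OUsigma t) ^ 2)⁻¹ * B) (p : (Fin m₁ → ℝ) × (Fin m₂ → ℝ)) :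
    ‖lfull m₁ m₂ t₀ T s p.1 p.2 - ltrunc m₁ m₂ t₀ T C s p.1 p.2‖ₑ ≤
      ∫⁻ q, ENNReal.ofReal (kap q.1) * (ENNReal.ofReal (2 * B ^ 2 + lam) *
        Set.indicator {r : ((Fin m₁ → ℝ) × (Fin m₂ → ℝ)) × (ℝ × (Fin m₁ → ℝ)) |
      ¬ (norm2 r.1.1 ≤ C ∧ norm2 (OUalpha r.2.1 • r.1.1 + OUsigma r.2.1 • r.2.2) ≤ C)}
        (fun _ => (1 : ENNReal)) (p, q) + ENNReal.ofReal (lam⁻¹ * norm2 q.2 ^ 4))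
      ∂((volume.restrict (Set.Ioc t₀ T)).prod
        (gaussMeasure (0 : Fin m₁ → ℝ) (1 : Matrix (Fin m₁) (Fin m₁) ℝ))) := by
  obtain ⟨x, y⟩ := p
  set γ := gaussMeasure (0 : Fin m₁ → ℝ) (1 : Matrix (Fin m₁) (Fin m₁) ℝ) with hγ
  set τ := (volume : Measure ℝ).restrict (Set.Ioc t₀ T) with hτ
  have hn := norm2_meas m₁
  have hal := OUalpha_meas
  have hsi := OUsigma_meas
  let H : ℝ × (Fin m₁ → ℝ) → ℝ := fun q =>
    (norm2 (s (OUalpha q.1 • x + OUsigma q.1 • q.2) y q.1 + (OUsigma q.1)⁻¹ • q.2)) ^ 2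
  let G : Set (ℝ × (Fin m₁ → ℝ)) := {q | norm2 x ≤ C ∧ norm2 (OUalpha q.1 • x + OUsigma q.1 • q.2) ≤ C}
  have hGm : MeasurableSet G := by
    refine MeasurableSet.inter (MeasurableSet.const _) ?_
    exact measurableSet_le (hn.comp (by fun_prop)) measurable_const
  have hHm : Measurable H := by
    have : Measurable fun q : ℝ × (Fin m₁ → ℝ) => s (OUalpha q.1 • x + OUsigma q.1 • q.2) y q.1 :=
      hs.comp (g := fun p : (Fin m₁ → ℝ) × (Fin m₂ → ℝ) × ℝ => s p.1 p.2.1 p.2.2)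
        (f := fun q : ℝ × (Fin m₁ → ℝ) => (OUalpha q.1 • x + OUsigma q.1 • q.2, y, q.1))
        (by fun_prop)
    exact (hn.comp (by fun_prop)).pow_const 2
  have hmem : ∀ᵐ q ∂(τ.prod γ), q.1 ∈ Set.Ioc t₀ T :=
    Measure.quasiMeasurePreserving_fst.ae (ae_restrict_mem measurableSet_Ioc)
  have hHle : ∀ᵐ q ∂(τ.prod γ), H q ≤ 2 * kap q.1 * (B ^ 2 + norm2 q.2 ^ 2) := by
    filter_upwards [hmem] with q hq
    exact H_le (h0.trans hq.1) _ _ (hb _ _ _ ⟨hq.1.le, hq.2⟩)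
  have hH0 : ∀ q, 0 ≤ H q := fun q => sq_nonneg _
  have hdom : Integrable (fun q : ℝ × (Fin m₁ → ℝ) => kap q.1 * (2 * B ^ 2 + 1 + norm2 q.2 ^ 4))
      (τ.prod γ) :=
    Integrable.mul_prod (f := kap) (g := fun z => 2 * B ^ 2 + 1 + norm2 z ^ 4)
      (kap_int h0 hT).1 ((integrable_const _).add (four_moment m₁).1)
  have hHi : Integrable H (τ.prod γ) := by
    refine hdom.mono' hHm.aestronglyMeasurable ?_
    filter_upwards [hHle] with q hq
    rw [Real.norm_of_nonneg (hH0 q)]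
    refine hq.trans ?_
    have := mul_nonneg (kap_nonneg q.1) (sq_nonneg (norm2 q.2 ^ 2 - 1))
    nlinarith
  have hGi : Integrable (G.indicator H) (τ.prod γ) := hHi.indicator hGm
  have e1 : lfull m₁ m₂ t₀ T s x y = ∫ q, H q ∂(τ.prod γ) := by
    rw [integral_prod _ hHi, lfull, intervalIntegral.integral_of_le hT]
  have e2 : ltrunc m₁ m₂ t₀ T C s x y = ∫ q, G.indicator H q ∂(τ.prod γ) := by
    rw [integral_prod _ hGi, ltrunc, intervalIntegral.integral_of_le hT]
    rfl
  simp only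
  rw [e1, e2, ← integral_sub hHi hGi]
  refine (enorm_integral_le_lintegral_enorm _).trans (lintegral_mono_ae ?_)
  filter_upwards [hHle] with q hq
  by_cases hqG : q ∈ G
  · simp [Set.indicator_of_mem hqG]
  · rw [Set.indicator_of_notMem hqG, Set.indicator_of_mem (by exact hqG), sub_zero,
      Real.enorm_eq_ofReal (hH0 q), mul_one, ← ENNReal.ofReal_add (by positivity)
      (by have := norm2_nonneg_s14 q.2; positivity), ← ENNReal.ofReal_mul (kap_nonneg _)]
    apply ENNReal.ofReal_le_ofReal
    refine hq.trans ?_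
    rw [mul_comm 2, mul_assoc]
    apply mul_le_mul_of_nonneg_left _ (kap_nonneg _)
    have h5 : 2 * norm2 q.2 ^ 2 ≤ lam + lam⁻¹ * norm2 q.2 ^ 4 := by
      have : lam + lam⁻¹ * norm2 q.2 ^ 4 - 2 * norm2 q.2 ^ 2 = lam⁻¹ * (lam - norm2 q.2 ^ 2) ^ 2 := by
        field_simp; ring
      have h6 : 0 ≤ lam⁻¹ * (lam - norm2 q.2 ^ 2) ^ 2 := by positivity
      linarith
    linarith

/-- there is an absolute constant `c > 0` such that, if the truncation
event fails with probability at most `δ_d` for every `t ∈ [t₀, T]` and the score network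
is bounded by `σ_t⁻²B`, then the expected gap between the full and truncated
score-matching losses is at most `c√δ_d (B² + m₁)(T + 1/t₀)`. -/
theorem expected_truncation_gap_bound :
    ∃ c : ℝ, 0 < c ∧
    ∀ (m₁ m₂ : ℕ), 1 ≤ m₁ → 1 ≤ m₂ →
    ∀ (t₀ T C B δd : ℝ), 0 < t₀ → t₀ ≤ 1 → 1 ≤ T → 0 < C → 0 < B →
      0 < δd → δd ≤ 1 →
    ∀ ν : Measure ((Fin m₁ → ℝ) × (Fin m₂ → ℝ)), IsProbabilityMeasure ν →
    (∀ t : ℝ, t ∈ Set.Icc t₀ T →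
      (ν.prod (gaussMeasure (0 : Fin m₁ → ℝ) (1 : Matrix (Fin m₁) (Fin m₁) ℝ)))
        {p | ¬ (norm2 p.1.1 ≤ C ∧ norm2 (OUalpha t • p.1.1 + OUsigma t • p.2) ≤ C)}
        ≤ ENNReal.ofReal δd) →
    ∀ s : (Fin m₁ → ℝ) → (Fin m₂ → ℝ) → ℝ → (Fin m₁ → ℝ),
      (Measurable fun p : (Fin m₁ → ℝ) × (Fin m₂ → ℝ) × ℝ => s p.1 p.2.1 p.2.2) →
      (∀ (v : Fin m₁ → ℝ) (y : Fin m₂ → ℝ) (t : ℝ), t ∈ Set.Icc t₀ T →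
        norm2 (s v y t) ≤ ((OUsigma t) ^ 2)⁻¹ * B) →
      (∫ p, |lfull m₁ m₂ t₀ T s p.1 p.2 - ltrunc m₁ m₂ t₀ T C s p.1 p.2| ∂ν) ≤
        c * Real.sqrt δd * (B ^ 2 + m₁) * (T + 1 / t₀) := by
  refine ⟨2 * (2 + Kfour), by have := Kfour_nonneg; positivity, ?_⟩
  intro m₁ m₂ hm₁ _ t₀ T C B δ h0 h01 h1T _ _ hδ hδ1 ν hν hbad s hs hb
  have hK := Kfour_nonneg
  have hT : t₀ ≤ T := h01.trans h1T
  have hm : (0 : ℝ) < m₁ := by exact_mod_cast hm₁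
  have hsq : 0 < Real.sqrt δ := Real.sqrt_pos.2 hδ
  set lam : ℝ := m₁ / Real.sqrt δ with hlamdef
  have hlam : 0 < lam := by positivity
  set γ := gaussMeasure (0 : Fin m₁ → ℝ) (1 : Matrix (Fin m₁) (Fin m₁) ℝ) with hγ
  set τ := (volume : Measure ℝ).restrict (Set.Ioc t₀ T) with hτ
  set Bad := {r : ((Fin m₁ → ℝ) × (Fin m₂ → ℝ)) × (ℝ × (Fin m₁ → ℝ)) |
      ¬ (norm2 r.1.1 ≤ C ∧ norm2 (OUalpha r.2.1 • r.1.1 + OUsigma r.2.1 • r.2.2) ≤ C)} with hBad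
  have hBm : MeasurableSet Bad := badset_meas m₁ m₂ C
  have hn := norm2_meas m₁
  have hk := kap_meas
  let F : ((Fin m₁ → ℝ) × (Fin m₂ → ℝ)) × (ℝ × (Fin m₁ → ℝ)) → ENNReal := fun r =>
    ENNReal.ofReal (kap r.2.1) * (ENNReal.ofReal (2 * B ^ 2 + lam) *
        Bad.indicator (fun _ => (1 : ENNReal)) r + ENNReal.ofReal (lam⁻¹ * norm2 r.2.2 ^ 4))
  have hFm : Measurable F := by
    have h1 : Measurable (Bad.indicator (fun _ => (1 : ENNReal))) := measurable_const.indicator hBm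
    fun_prop
  have key : ∫⁻ p, ‖lfull m₁ m₂ t₀ T s p.1 p.2 - ltrunc m₁ m₂ t₀ T C s p.1 p.2‖ₑ ∂ν ≤
      ENNReal.ofReal (2 * (2 + Kfour) * Real.sqrt δ * (B ^ 2 + m₁) * (T + 1 / t₀)) := by
    calc _ ≤ ∫⁻ p, ∫⁻ q, F (p, q) ∂(τ.prod γ) ∂ν :=
          lintegral_mono fun p => gap_le m₁ m₂ t₀ T C B lam h0 hT hlam s hs hb p
      _ = ∫⁻ p, ∫⁻ t, ∫⁻ z, F (p, (t, z)) ∂γ ∂τ ∂ν := by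
          refine lintegral_congr fun p => ?_
          rw [lintegral_prod _ (by fun_prop)]
      _ = ∫⁻ t, ∫⁻ p, ∫⁻ z, F (p, (t, z)) ∂γ ∂ν ∂τ := by
          rw [lintegral_lintegral_swap]
          refine Measurable.aemeasurable ?_
          exact Measurable.lintegral_prod_right'
            (f := fun r : (((Fin m₁ → ℝ) × (Fin m₂ → ℝ)) × ℝ) × (Fin m₁ → ℝ) =>
              F (r.1.1, (r.1.2, r.2))) (by fun_prop)
      _ ≤ ∫⁻ t, ENNReal.ofReal (kap t) *
            ENNReal.ofReal ((2 + Kfour) * Real.sqrt δ * (B ^ 2 + m₁)) ∂τ := by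
          refine lintegral_mono_ae ?_
          filter_upwards [ae_restrict_mem measurableSet_Ioc] with t ht
          rw [← lintegral_prod (fun r : ((Fin m₁ → ℝ) × (Fin m₂ → ℝ)) × (Fin m₁ → ℝ) =>
            F (r.1, (t, r.2))) (by fun_prop)]
          have hbt := hbad t ⟨ht.1.le, ht.2⟩
          have hBt : MeasurableSet {p : ((Fin m₁ → ℝ) × (Fin m₂ → ℝ)) × (Fin m₁ → ℝ) |
              ¬ (norm2 p.1.1 ≤ C ∧ norm2 (OUalpha t • p.1.1 + OUsigma t • p.2) ≤ C)} :=
            hBm.preimage (f := fun p : ((Fin m₁ → ℝ) × (Fin m₂ → ℝ)) × (Fin m₁ → ℝ) =>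
              (p.1, (t, p.2))) (by fun_prop)
          set Bt := {p : ((Fin m₁ → ℝ) × (Fin m₂ → ℝ)) × (Fin m₁ → ℝ) |
              ¬ (norm2 p.1.1 ≤ C ∧ norm2 (OUalpha t • p.1.1 + OUsigma t • p.2) ≤ C)} with hBtd
          have hF : ∀ r : ((Fin m₁ → ℝ) × (Fin m₂ → ℝ)) × (Fin m₁ → ℝ), F (r.1, (t, r.2)) =
              ENNReal.ofReal (kap t) * (ENNReal.ofReal (2 * B ^ 2 + lam) *
                Bt.indicator 1 r + ENNReal.ofReal (lam⁻¹ * norm2 r.2 ^ 4)) := fun r => rfl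
          have hi1 : Measurable (Bt.indicator (1 : ((Fin m₁ → ℝ) × (Fin m₂ → ℝ)) × (Fin m₁ → ℝ) → ENNReal)) := measurable_one.indicator hBt
          simp_rw [hF]
          rw [lintegral_const_mul _ (by fun_prop), lintegral_add_left (by fun_prop),
            lintegral_const_mul _ hi1, lintegral_indicator_one hBt]
          gcongr
          have hw : ∫⁻ r : ((Fin m₁ → ℝ) × (Fin m₂ → ℝ)) × (Fin m₁ → ℝ),
              ENNReal.ofReal (lam⁻¹ * norm2 r.2 ^ 4) ∂(ν.prod γ) ≤
              ENNReal.ofReal (lam⁻¹ * (m₁ ^ 2 * Kfour)) := by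
            rw [lintegral_prod _ (by fun_prop)]
            simp only [lintegral_const, measure_univ, mul_one]
            rw [← ofReal_integral_eq_lintegral_ofReal ((four_moment m₁).1.const_mul _)
              (ae_of_all _ fun z => by have := norm2_nonneg_s14 z; positivity), integral_const_mul]
            apply ENNReal.ofReal_le_ofReal
            exact mul_le_mul_of_nonneg_left (four_moment m₁).2 (by positivity)
          refine (add_le_add (mul_le_mul_right hbt _) hw).trans ?_
          rw [← ENNReal.ofReal_mul (by positivity), ← ENNReal.ofReal_add (by positivity)
            (by positivity)]
          apply ENNReal.ofReal_le_ofReal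
          have hss : Real.sqrt δ * Real.sqrt δ = δ := Real.mul_self_sqrt hδ.le
          have e1 : lam * δ = m₁ * Real.sqrt δ := by
            rw [hlamdef]; nth_rewrite 2 [← hss]; field_simp
          have e2 : lam⁻¹ * (m₁ ^ 2 * Kfour) = Real.sqrt δ * m₁ * Kfour := by
            rw [hlamdef]; field_simp
          have e3 : δ ≤ Real.sqrt δ := by
            have : Real.sqrt δ ≤ 1 := Real.sqrt_le_one.2 hδ1
            nlinarith
          rw [add_mul, e1, e2]
          have e4 := mul_le_mul_of_nonneg_left e3 (sq_nonneg B)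
          have e5 : 0 ≤ Kfour * Real.sqrt δ * B ^ 2 := by positivity
          have e6 : 0 ≤ Real.sqrt δ * m₁ := by positivity
          nlinarith
      _ ≤ _ := by
          rw [lintegral_mul_const _ (by fun_prop), ← ofReal_integral_eq_lintegral_ofReal
            (kap_int h0 hT).1 (ae_of_all _ kap_nonneg),
            ← ENNReal.ofReal_mul (integral_nonneg kap_nonneg)]
          apply ENNReal.ofReal_le_ofReal
          refine (mul_le_mul_of_nonneg_right (kap_int h0 hT).2 (by positivity)).trans ?_
          apply le_of_eq; ring
  have hfin : 0 ≤ 2 * (2 + Kfour) * Real.sqrt δ * (B ^ 2 + m₁) * (T + 1 / t₀) := by positivity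
  refine (le_abs_self _).trans ?_
  rw [← Real.norm_eq_abs]
  refine (norm_integral_le_lintegral_norm _).trans ?_
  refine ENNReal.toReal_le_of_le_ofReal hfin ?_
  refine le_trans (le_of_eq (lintegral_congr fun p => ?_)) key
  rw [ofReal_norm, Real.enorm_abs]

end
end

section
/- There exist absolute constants c > 0 and n₀ ≥ 1 with the following property. Assume λ_max(Γ) ≤ 1 and λ_max(Λ) ≤ 1, write m₁ = d|I_miss|, and for y ∈ ℝ^(d|I_obs|) set μ_cond(y) = Σ_corᵀ Σ_obs^(−1) y. For t₀ > 0 define the Gaussian measures P(·|y) = N(μ_cond(y), Σ_cond) and P_{t₀}(·|y) = N(α_{t₀} μ_cond(y), α_{t₀}²Σ_cond + σ_{t₀}²I_{m₁}) on ℝ^(m₁). Then for every integer n ≥ n₀ and every t₀ with 0 < t₀ ≤ λ_min(Σ_cond)·n^(−1/2): E_{y~N(0,Σ_obs)}[ TV(P(·|y), P_{t₀}(·|y)) ] ≤ c·√(Hd/n), where TV denotes the total variation distance between probability measures. -/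
open Matrix MeasureTheory
open scoped Kronecker BigOperators

noncomputable section

/-- Total variation distance between two measures. -/
def TVdist {α : Type*} [MeasurableSpace α] (μ ν : Measure α) : ℝ :=
  ⨆ s : {s : Set α // MeasurableSet s}, |(μ s.1).toReal - (ν s.1).toReal|

set_option linter.unusedSectionVars false

section MatrixLemmas

variable {ι κ : Type*} [Fintype ι] [DecidableEq ι] [Fintype κ] [DecidableEq κ]

open scoped MatrixOrder ComplexOrder in
lemma psd_factor {A : Matrix ι ι ℝ} (hA : A.PosSemidef) :
    ∃ R : Matrix ι ι ℝ, A = Rᵀ * R := by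
  obtain ⟨B, h⟩ := CStarAlgebra.nonneg_iff_eq_star_mul_self.mp hA.nonneg
  exact ⟨B, by simpa [star_eq_conjTranspose] using h⟩

lemma psd_conj {A : Matrix ι ι ℝ} (hA : A.PosSemidef) (B : Matrix ι κ ℝ) :
    (Bᵀ * A * B).PosSemidef := by
  simpa using hA.conjTranspose_mul_mul_same B

lemma psd_sq {A : Matrix ι ι ℝ} (hA : A.IsSymm) : (A * A).PosSemidef := by
  have := psd_conj (Matrix.PosSemidef.one (n := ι) (R := ℝ)) A
  rw [hA.eq] at this
  simpa using this

lemma trace_mul_nonneg_psd {A B : Matrix ι ι ℝ} (hA : A.PosSemidef) (hB : B.PosSemidef) :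
    0 ≤ (A * B).trace := by
  obtain ⟨R, rfl⟩ := psd_factor hA
  have h : (Rᵀ * R * B).trace = (R * B * Rᵀ).trace := by
    rw [Matrix.trace_mul_comm (R * B), ← Matrix.mul_assoc]
  rw [h]
  simpa using (hB.mul_mul_conjTranspose_same R).trace_nonneg

lemma det_le_exp_trace {A : Matrix ι ι ℝ} (hA : A.PosSemidef) :
    A.det ≤ Real.exp (A.trace - Fintype.card ι) := by
  rw [hA.isHermitian.det_eq_prod_eigenvalues, hA.isHermitian.trace_eq_sum_eigenvalues]
  have : (∑ i, ((hA.isHermitian.eigenvalues i : ℝ)) - (Fintype.card ι : ℝ))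
      = ∑ i, (hA.isHermitian.eigenvalues i - 1) := by
    simp [Finset.sum_sub_distrib]
  simp only [RCLike.ofReal_real_eq_id, id] 
  rw [this, Real.exp_sum]
  refine Finset.prod_le_prod (fun i _ => hA.eigenvalues_nonneg i) fun i _ => ?_
  have := Real.add_one_le_exp (hA.isHermitian.eigenvalues i - 1)
  linarith

lemma det_mul_le_exp {A B : Matrix ι ι ℝ} (hA : A.PosSemidef) (hB : B.PosSemidef) :
    A.det * B.det ≤ Real.exp ((A * B).trace - Fintype.card ι) := by
  obtain ⟨R, rfl⟩ := psd_factor hA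
  have h : (Rᵀ * R * B).trace = (R * B * Rᵀ).trace := by
    rw [Matrix.trace_mul_comm (R * B), ← Matrix.mul_assoc]
  rw [h]
  have := det_le_exp_trace (hB.mul_mul_conjTranspose_same R)
  simp only [Matrix.conjTranspose_eq_transpose_of_trivial] at this
  refine le_trans (le_of_eq ?_) this
  simp [Matrix.det_mul]; ring

lemma inv_le_aux {A : Matrix ι ι ℝ} (hA : A.PosDef) {l : ℝ} (hl : 0 < l)
    (h : (A - l • (1 : Matrix ι ι ℝ)).PosSemidef) :
    (l⁻¹ • (1 : Matrix ι ι ℝ) - A⁻¹).PosSemidef := by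
  have hu : IsUnit A.det := hA.det_pos.ne'.isUnit
  have hsA : A⁻¹ᵀ = A⁻¹ := by simpa using hA.inv.isHermitian.eq
  have h1 : ((1 - l • A⁻¹) * (1 - l • A⁻¹)).PosSemidef := by
    apply psd_sq
    simp [Matrix.IsSymm, hsA]
  have h2 := psd_conj h A⁻¹
  rw [hsA] at h2
  have h3 := (h1.add (h2.smul hl.le)).smul (inv_nonneg.mpr hl.le)
  have : A⁻¹ * A = 1 := Matrix.nonsing_inv_mul _ hu
  convert h3 using 1
  simp only [Matrix.mul_sub, Matrix.sub_mul, this, Matrix.mul_one, Matrix.one_mul,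
    Matrix.mul_smul, Matrix.smul_mul, smul_sub, smul_add, smul_smul]
  have e1 : l⁻¹ * l = 1 := inv_mul_cancel₀ hl.ne'
  have e2 : l⁻¹ * (l * l) = l := by field_simp
  simp only [e1, e2, one_smul]
  abel

lemma posDef_of_sub {A : Matrix ι ι ℝ} {l : ℝ} (hl : 0 < l)
    (h : (A - l • (1 : Matrix ι ι ℝ)).PosSemidef) : A.PosDef := by
  have : A = l • 1 + (A - l • (1 : Matrix ι ι ℝ)) := by abel
  rw [this]
  exact (Matrix.PosDef.one.smul hl).add_posSemidef h

lemma trace_inv_le {A : Matrix ι ι ℝ} {l : ℝ} (hl : 0 < l)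
    (h : (A - l • (1 : Matrix ι ι ℝ)).PosSemidef) {X : Matrix ι ι ℝ} (hX : X.PosSemidef) :
    (X * A⁻¹).trace ≤ l⁻¹ * X.trace := by
  have := trace_mul_nonneg_psd hX (inv_le_aux (posDef_of_sub hl h) hl h)
  simp [Matrix.mul_sub] at this
  linarith

/-- the trace estimate for equal means -/
lemma trace_bound {A : Matrix ι ι ℝ} {l s : ℝ} (hl : 0 < l) (hs : 0 ≤ s)
    (h : (A - l • (1 : Matrix ι ι ℝ)).PosSemidef) (h1 : (1 - A).PosSemidef)
    {B : Matrix ι ι ℝ} (hB : B = A + s • (1 - A)) :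
    (A * B⁻¹).trace + (B * A⁻¹).trace - 2 * Fintype.card ι ≤ (s / l) ^ 2 * Fintype.card ι := by
  have hBl : (B - l • (1 : Matrix ι ι ℝ)).PosSemidef := by
    have : B - l • (1 : Matrix ι ι ℝ) = (A - l • (1 : Matrix ι ι ℝ)) + s • (1 - A) := by
      rw [hB]; abel
    rw [this]; exact h.add (h1.smul hs)
  have hA := posDef_of_sub hl h
  have hB' := posDef_of_sub hl hBl
  have uA : A * A⁻¹ = 1 := Matrix.mul_nonsing_inv _ hA.det_pos.ne'.isUnit
  have uA' : A⁻¹ * A = 1 := Matrix.nonsing_inv_mul _ hA.det_pos.ne'.isUnit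
  have uB : B * B⁻¹ = 1 := Matrix.mul_nonsing_inv _ hB'.det_pos.ne'.isUnit
  have hsA : Aᵀ = A := by simpa using hA.isHermitian.eq
  have h1s : (1 - A)ᵀ = 1 - A := by simp [hsA]
  set E := 1 - A with hE
  have e1 : A * B⁻¹ = 1 - s • (E * B⁻¹) := by
    have : A = B - s • E := by rw [hB]; abel
    conv_lhs => rw [this]
    rw [Matrix.sub_mul, uB, Matrix.smul_mul]
  have e2 : B * A⁻¹ = 1 + s • (E * A⁻¹) := by
    rw [hB, Matrix.add_mul, uA, Matrix.smul_mul]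
  have e3 : A⁻¹ - B⁻¹ = s • (A⁻¹ * E * B⁻¹) := by
    have : s • (A⁻¹ * E * B⁻¹) = A⁻¹ * (s • E) * B⁻¹ := by simp
    have h4 : s • E = B - A := by rw [hB]; abel
    rw [this, h4, Matrix.mul_sub, Matrix.sub_mul, Matrix.mul_assoc, uB, uA']
    simp
  have e4 : (A * B⁻¹).trace + (B * A⁻¹).trace - 2 * Fintype.card ι
      = s ^ 2 * (E * A⁻¹ * E * B⁻¹).trace := by
    have : (E * A⁻¹).trace - (E * B⁻¹).trace = s * (E * A⁻¹ * E * B⁻¹).trace := by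
      rw [← Matrix.trace_sub, ← Matrix.mul_sub, e3]
      simp [Matrix.mul_assoc]
    rw [e1, e2, Matrix.trace_sub, Matrix.trace_add, Matrix.trace_smul, Matrix.trace_smul,
      Matrix.trace_one, smul_eq_mul, smul_eq_mul]
    linear_combination s * this
  rw [e4]
  have p1 : (E * A⁻¹ * E).PosSemidef := by
    have := psd_conj hA.inv.posSemidef E
    rwa [h1s] at this
  have t1 := trace_inv_le hl hBl p1
  have t2 : (E * A⁻¹ * E).trace ≤ l⁻¹ * (E * E).trace := by
    rw [Matrix.trace_mul_comm, ← Matrix.mul_assoc]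
    exact trace_inv_le hl h (psd_sq h1s)
  have t3 : (E * E).trace ≤ Fintype.card ι := by
    have a1 := trace_mul_nonneg_psd h1 hA.posSemidef
    have a2 := hA.posSemidef.trace_nonneg
    have a3 : A = 1 - E := by rw [hE]; abel
    have a4 : A.trace = Fintype.card ι - E.trace := by
      conv_lhs => rw [a3]
      simp
    have a5 : (E * A).trace = E.trace - (E * E).trace := by
      conv_lhs => rw [a3]
      simp [Matrix.mul_sub]
    linarith
  have hl' : 0 < l⁻¹ := inv_pos.mpr hl
  calc s ^ 2 * (E * A⁻¹ * E * B⁻¹).trace ≤ s ^ 2 * (l⁻¹ * (l⁻¹ * Fintype.card ι)) := by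
        gcongr
        refine t1.trans ?_
        gcongr
        refine t2.trans ?_
        gcongr
    _ = _ := by ring

lemma quad_bdd (A : Matrix ι ι ℝ) (v : ι → ℝ) (hv : ∑ i, v i ^ 2 = 1) :
    v ⬝ᵥ (A *ᵥ v) ≤ ∑ i, ∑ j, |A i j| := by
  have hb : ∀ i, |v i| ≤ 1 := by
    intro i
    rw [← sq_le_one_iff_abs_le_one, ← hv]
    exact Finset.single_le_sum (f := fun i => v i ^ 2) (fun _ _ => sq_nonneg _) (Finset.mem_univ i)
  simp only [dotProduct, Matrix.mulVec, Finset.mul_sum]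
  refine Finset.sum_le_sum fun i _ => Finset.sum_le_sum fun j _ => ?_
  refine (le_abs_self _).trans ?_
  rw [abs_mul, abs_mul]
  calc |v i| * (|A i j| * |v j|) ≤ 1 * (|A i j| * 1) := by
        gcongr
        · exact hb i
        · exact hb j
    _ = _ := by ring

lemma quad_scale (A : Matrix ι ι ℝ) (x : ι → ℝ) (hx : x ≠ 0) :
    ∃ v : ι → ℝ, ∑ i, v i ^ 2 = 1 ∧ x ⬝ᵥ (A *ᵥ x) = (x ⬝ᵥ x) * (v ⬝ᵥ (A *ᵥ v)) := by
  have hpos : 0 < x ⬝ᵥ x := by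
    have h0 : 0 ≤ x ⬝ᵥ x := Finset.sum_nonneg fun i _ => mul_self_nonneg _
    exact lt_of_le_of_ne h0 fun h => hx (dotProduct_self_eq_zero.mp h.symm)
  set r := Real.sqrt (x ⬝ᵥ x) with hr
  have hrp : 0 < r := Real.sqrt_pos.mpr hpos
  have hr2 : x ⬝ᵥ x = r ^ 2 := (Real.sq_sqrt hpos.le).symm
  refine ⟨r⁻¹ • x, ?_, ?_⟩
  · have : ∑ i, (r⁻¹ • x) i ^ 2 = r⁻¹ ^ 2 * (x ⬝ᵥ x) := by
      simp only [dotProduct, Finset.mul_sum, Pi.smul_apply, smul_eq_mul]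
      exact Finset.sum_congr rfl fun i _ => by ring
    rw [this, hr2]; field_simp
  · rw [hr2, Matrix.mulVec_smul, smul_dotProduct, dotProduct_smul, smul_eq_mul, smul_eq_mul]
    field_simp

lemma psd_of_lamMax {A : Matrix ι ι ℝ} (hA : A.IsHermitian) (h : lamMax A ≤ 1) :
    (1 - A).PosSemidef := by
  refine Matrix.PosSemidef.of_dotProduct_mulVec_nonneg (Matrix.isHermitian_one.sub hA) fun x => ?_
  by_cases hx : x = 0
  · simp [hx]
  obtain ⟨v, hv, e⟩ := quad_scale A x hx
  have hle : v ⬝ᵥ (A *ᵥ v) ≤ 1 := by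
    refine le_trans ?_ h
    refine le_ciSup (f := fun v : {v : ι → ℝ // ∑ i, v i ^ 2 = 1} => v.1 ⬝ᵥ (A *ᵥ v.1))
      ⟨∑ i, ∑ j, |A i j|, ?_⟩ ⟨v, hv⟩
    rintro _ ⟨w, rfl⟩
    exact quad_bdd A w.1 w.2
  have h0 : 0 ≤ x ⬝ᵥ x := Finset.sum_nonneg fun i _ => mul_self_nonneg _
  simp only [star_trivial, Matrix.sub_mulVec, Matrix.one_mulVec, dotProduct_sub]
  rw [e]; nlinarith

lemma psd_of_lamMin {A : Matrix ι ι ℝ} (hA : A.IsHermitian) (h : 0 < lamMin A) :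
    (A - lamMin A • (1 : Matrix ι ι ℝ)).PosSemidef := by
  refine Matrix.PosSemidef.of_dotProduct_mulVec_nonneg (hA.sub ?_) fun x => ?_
  · simp [Matrix.IsHermitian]
  by_cases hx : x = 0
  · simp [hx]
  obtain ⟨v, hv, e⟩ := quad_scale A x hx
  have hle : lamMin A ≤ v ⬝ᵥ (A *ᵥ v) := by
    refine ciInf_le (f := fun v : {v : ι → ℝ // ∑ i, v i ^ 2 = 1} => v.1 ⬝ᵥ (A *ᵥ v.1))
      ?_ ⟨v, hv⟩
    by_contra hb
    exact h.ne' (Real.iInf_of_not_bddBelow hb)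
  have h0 : 0 ≤ x ⬝ᵥ x := Finset.sum_nonneg fun i _ => mul_self_nonneg _
  simp only [star_trivial, Matrix.sub_mulVec, Matrix.smul_mulVec, Matrix.one_mulVec,
    dotProduct_sub, dotProduct_smul, smul_eq_mul]
  rw [e]; nlinarith

end MatrixLemmas

section GaussLemmas

variable {ι : Type*} [Fintype ι] [DecidableEq ι]

lemma gauss_std :
    Integrable (fun x : ι → ℝ => Real.exp (-(x ⬝ᵥ x) / 2)) ∧
    ∫ x : ι → ℝ, Real.exp (-(x ⬝ᵥ x) / 2) = Real.sqrt (2 * Real.pi) ^ Fintype.card ι := by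
  have e : (fun x : ι → ℝ => Real.exp (-(x ⬝ᵥ x) / 2))
      = fun x : ι → ℝ => ∏ i, Real.exp (-(1 / 2) * x i ^ 2) := by
    funext x
    rw [← Real.exp_sum]
    congr 1
    simp only [dotProduct, ← Finset.sum_neg_distrib, Finset.sum_div]
    exact Finset.sum_congr rfl fun i _ => by ring
  rw [e]
  constructor
  · exact Integrable.fintype_prod (f := fun _ (t : ℝ) => Real.exp (-(1 / 2) * t ^ 2))
      fun _ => integrable_exp_neg_mul_sq (by norm_num)
  · rw [integral_fintype_prod_volume_eq_prod (fun _ (t : ℝ) => Real.exp (-(1 / 2) * t ^ 2))]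
    simp only [integral_gaussian, Finset.prod_const, Finset.card_univ]
    congr 2
    ring

lemma gauss_int {P : Matrix ι ι ℝ} (hP : P.PosDef) :
    Integrable (fun x : ι → ℝ => Real.exp (-(x ⬝ᵥ (P *ᵥ x)) / 2)) ∧
    ∫ x : ι → ℝ, Real.exp (-(x ⬝ᵥ (P *ᵥ x)) / 2)
      = Real.sqrt ((2 * Real.pi) ^ Fintype.card ι / P.det) := by
  obtain ⟨R, hR⟩ := psd_factor hP.posSemidef
  have hdet : P.det = R.det ^ 2 := by rw [hR, Matrix.det_mul, Matrix.det_transpose]; ring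
  have hR0 : R.det ≠ 0 := by
    intro h
    have := hP.det_pos
    rw [hdet, h] at this
    simp at this
  have e : (fun x : ι → ℝ => Real.exp (-(x ⬝ᵥ (P *ᵥ x)) / 2))
      = fun x => (fun u : ι → ℝ => Real.exp (-(u ⬝ᵥ u) / 2)) (Matrix.toLin' R x) := by
    funext x
    simp only [Matrix.toLin'_apply]
    rw [hR, ← Matrix.mulVec_mulVec, Matrix.dotProduct_mulVec, Matrix.vecMul_transpose]
  have hmeas : Measurable (Matrix.toLin' R) :=
    (LinearMap.continuous_on_pi _).measurable
  have hmap := Real.map_matrix_volume_pi_eq_smul_volume_pi hR0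
  obtain ⟨i1, i2⟩ := gauss_std (ι := ι)
  have hint : Integrable (fun u : ι → ℝ => Real.exp (-(u ⬝ᵥ u) / 2))
      (Measure.map (Matrix.toLin' R) volume) := by
    rw [hmap]; exact i1.smul_measure ENNReal.ofReal_ne_top
  rw [e]
  constructor
  · exact hint.comp_measurable hmeas
  · rw [← integral_map hmeas.aemeasurable hint.aestronglyMeasurable, hmap,
      integral_smul_measure, i2, hdet, Real.sqrt_div (by positivity), Real.sqrt_sq_eq_abs,
      ENNReal.toReal_ofReal (abs_nonneg _), abs_inv, smul_eq_mul]
    have : Real.sqrt ((2 * Real.pi) ^ Fintype.card ι)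
        = Real.sqrt (2 * Real.pi) ^ Fintype.card ι := by
      rw [← Real.sqrt_sq (show 0 ≤ Real.sqrt (2 * Real.pi) ^ Fintype.card ι by positivity)]
      congr 1
      rw [← pow_mul, mul_comm (Fintype.card ι), pow_mul, Real.sq_sqrt (by positivity)]
    rw [this]
    field_simp

lemma gd_cont (μ : ι → ℝ) (S : Matrix ι ι ℝ) : Continuous (gaussDensity μ S) := by
  unfold gaussDensity
  fun_prop

lemma gd_nonneg (μ : ι → ℝ) (S : Matrix ι ι ℝ) (x : ι → ℝ) : 0 ≤ gaussDensity μ S x := by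
  unfold gaussDensity
  positivity

lemma gd_int (μ : ι → ℝ) {S : Matrix ι ι ℝ} (hS : S.PosDef) :
    Integrable (gaussDensity μ S) ∧ ∫ x, gaussDensity μ S x = 1 := by
  obtain ⟨i1, i2⟩ := gauss_int hS.inv
  have h := hS.det_pos
  unfold gaussDensity
  constructor
  · exact (i1.comp_sub_right μ).const_mul _
  · rw [integral_const_mul,
      integral_sub_right_eq_self (fun x => Real.exp (-(x ⬝ᵥ (S⁻¹ *ᵥ x)) / 2)) μ, i2,
      Matrix.det_nonsing_inv, Ring.inverse_eq_inv', div_inv_eq_mul]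
    exact inv_mul_cancel₀ (by positivity)

lemma gm_apply (μ : ι → ℝ) (S : Matrix ι ι ℝ) {s : Set (ι → ℝ)}
    (hs : MeasurableSet s) :
    (gaussMeasure μ S s).toReal = ∫ x in s, gaussDensity μ S x := by
  unfold gaussMeasure
  rw [withDensity_apply _ hs, integral_eq_lintegral_of_nonneg_ae
    (Filter.Eventually.of_forall (gd_nonneg μ S)) (gd_cont μ S).aestronglyMeasurable]

lemma gm_prob (μ : ι → ℝ) {S : Matrix ι ι ℝ} (hS : S.PosDef) :
    IsProbabilityMeasure (gaussMeasure μ S) := by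
  constructor
  unfold gaussMeasure
  rw [withDensity_apply _ MeasurableSet.univ, Measure.restrict_univ,
    ← ofReal_integral_eq_lintegral_ofReal (gd_int μ hS).1
      (Filter.Eventually.of_forall (gd_nonneg μ S)), (gd_int μ hS).2, ENNReal.ofReal_one]

lemma pt_bound {a b k : ℝ} (ha : 0 ≤ a) (hb : 0 ≤ b) (hk : 0 < k) :
    |a - b| ≤ (a + b - 2 * Real.sqrt (a * b)) / (2 * k) + k * (a + b) := by
  rw [Real.sqrt_mul ha]
  obtain ⟨u, hu, rfl⟩ : ∃ u, 0 ≤ u ∧ a = u ^ 2 :=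
    ⟨Real.sqrt a, Real.sqrt_nonneg _, (Real.sq_sqrt ha).symm⟩
  obtain ⟨v, hv, rfl⟩ : ∃ v, 0 ≤ v ∧ b = v ^ 2 :=
    ⟨Real.sqrt b, Real.sqrt_nonneg _, (Real.sq_sqrt hb).symm⟩
  rw [Real.sqrt_sq hu, Real.sqrt_sq hv]
  have e : (u ^ 2 + v ^ 2 - 2 * (u * v)) / (2 * k) = (u - v) ^ 2 / (2 * k) := by ring
  rw [e]
  have h1 : |u ^ 2 - v ^ 2| = |u - v| * (u + v) := by
    rw [show u ^ 2 - v ^ 2 = (u - v) * (u + v) by ring, abs_mul, abs_of_nonneg (add_nonneg hu hv)]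
  rw [h1, ← sq_abs (u - v)]
  set w := |u - v|
  have h2 : w ^ 2 / (2 * k) + k * (u ^ 2 + v ^ 2) - w * (u + v)
      = ((w - k * (u + v)) ^ 2 + k ^ 2 * (u - v) ^ 2) / (2 * k) := by
    field_simp; ring
  have h3 : 0 ≤ ((w - k * (u + v)) ^ 2 + k ^ 2 * (u - v) ^ 2) / (2 * k) := by positivity
  linarith

lemma tv_set (μ ν : ι → ℝ) {A B : Matrix ι ι ℝ} (hA : A.PosDef) (hB : B.PosDef)
    {k : ℝ} (hk : 0 < k) {s : Set (ι → ℝ)} (hs : MeasurableSet s) :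
    |(gaussMeasure μ A s).toReal - (gaussMeasure ν B s).toReal| ≤
      (1 - ∫ x, Real.sqrt (gaussDensity μ A x * gaussDensity ν B x)) / k + 2 * k := by
  rw [gm_apply μ A hs, gm_apply ν B hs]
  obtain ⟨f1, f2⟩ := gd_int μ hA
  obtain ⟨g1, g2⟩ := gd_int ν hB
  set f := gaussDensity μ A
  set g := gaussDensity ν B
  have f0 : ∀ x, 0 ≤ f x := gd_nonneg μ A
  have g0 : ∀ x, 0 ≤ g x := gd_nonneg ν B
  have hh : Integrable (fun x => Real.sqrt (f x * g x)) := by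
    refine (f1.add g1).mono' ?_ (Filter.Eventually.of_forall fun x => ?_)
    · exact (((gd_cont μ A).mul (gd_cont ν B)).sqrt).aestronglyMeasurable
    · rw [Real.norm_of_nonneg (Real.sqrt_nonneg _)]
      refine Real.sqrt_le_iff.mpr ⟨add_nonneg (f0 x) (g0 x), ?_⟩
      simp only [Pi.add_apply]
      nlinarith [f0 x, g0 x, mul_nonneg (f0 x) (g0 x)]
  rw [← integral_sub f1.integrableOn g1.integrableOn]
  have i3 : Integrable (fun x => (f x + g x - 2 * Real.sqrt (f x * g x)) / (2 * k)
      + k * (f x + g x)) :=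
    (((f1.add g1).sub (hh.const_mul 2)).div_const _).add ((f1.add g1).const_mul k)
  calc |∫ x in s, (f x - g x)| ≤ ∫ x in s, |f x - g x| := abs_integral_le_integral_abs
    _ ≤ ∫ x, |f x - g x| := setIntegral_le_integral (f1.sub g1).abs
        (Filter.Eventually.of_forall fun x => abs_nonneg _)
    _ ≤ ∫ x, ((f x + g x - 2 * Real.sqrt (f x * g x)) / (2 * k) + k * (f x + g x)) :=
        integral_mono (f1.sub g1).abs i3 fun x => pt_bound (f0 x) (g0 x) hk
    _ = _ := by
        have j1 : Integrable (fun x => f x + g x) := f1.add g1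
        have j2 : Integrable (fun x => 2 * Real.sqrt (f x * g x)) := hh.const_mul 2
        have j3 : Integrable (fun x => f x + g x - 2 * Real.sqrt (f x * g x)) := j1.sub j2
        rw [integral_add (j3.div_const _) (j1.const_mul k), integral_div, integral_const_mul,
          integral_sub j1 j2, integral_const_mul, integral_add f1 g1, f2, g2]
        field_simp
        ring

lemma bc_same_cov (μ ν : ι → ℝ) {A : Matrix ι ι ℝ} (hA : A.PosDef) :
    ∫ x, Real.sqrt (gaussDensity μ A x * gaussDensity ν A x)
      = Real.exp (-((μ - ν) ⬝ᵥ (A⁻¹ *ᵥ (μ - ν))) / 8) := by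
  have e : ∀ x, Real.sqrt (gaussDensity μ A x * gaussDensity ν A x)
      = gaussDensity ((1 / 2 : ℝ) • (μ + ν)) A x
        * Real.exp (-((μ - ν) ⬝ᵥ (A⁻¹ *ᵥ (μ - ν))) / 8) := by
    intro x
    have hs : A⁻¹ᵀ = A⁻¹ := by simpa using hA.inv.isHermitian.eq
    set m := (1 / 2 : ℝ) • (μ + ν) with hm
    set w := (1 / 2 : ℝ) • (μ - ν) with hw
    have e1 : x - μ = (x - m) - w := by
      rw [hm, hw]; ext i; simp; ring
    have e2 : x - ν = (x - m) + w := by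
      rw [hm, hw]; ext i; simp; ring
    have e3 : μ - ν = (2 : ℝ) • w := by
      rw [hw]; ext i; simp
    rw [Real.sqrt_eq_iff_mul_self_eq (mul_nonneg (gd_nonneg _ _ _) (gd_nonneg _ _ _))
      (mul_nonneg (gd_nonneg _ _ _) (Real.exp_nonneg _))]
    unfold gaussDensity
    rw [e1, e2, e3]
    generalize x - m = z
    have key : ∀ c a b d f : ℝ, a + b = 2 * d + 2 * f →
        c * Real.exp d * Real.exp f * (c * Real.exp d * Real.exp f)
        = c * Real.exp a * (c * Real.exp b) := by
      intro c a b d f h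
      have : Real.exp a * Real.exp b = Real.exp d * Real.exp f * (Real.exp d * Real.exp f) := by
        rw [← Real.exp_add, ← Real.exp_add, ← Real.exp_add, h]; ring_nf
      linear_combination (-c * c) * this
    symm
    apply key
    simp only [Matrix.mulVec_sub, Matrix.mulVec_add, Matrix.mulVec_smul, sub_dotProduct,
      add_dotProduct, dotProduct_sub, dotProduct_add, smul_dotProduct, dotProduct_smul, smul_eq_mul]
    ring
  simp_rw [e]
  rw [integral_mul_const, (gd_int _ hA).2, one_mul]

lemma bc_same_mean (μ : ι → ℝ) {A B : Matrix ι ι ℝ} (hA : A.PosDef) (hB : B.PosDef) :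
    1 - ((A * B⁻¹).trace + (B * A⁻¹).trace - 2 * Fintype.card ι) / 8
      ≤ ∫ x, Real.sqrt (gaussDensity μ A x * gaussDensity μ B x) := by
  set M := (1 / 2 : ℝ) • (A⁻¹ + B⁻¹) with hM
  have hMp : M.PosDef := (hA.inv.add hB.inv).smul (by norm_num)
  set T := (A * B⁻¹).trace + (B * A⁻¹).trace - 2 * Fintype.card ι with hT
  set N := (2 * Real.pi) ^ Fintype.card ι with hN
  have hNp : 0 < N := by positivity
  have a0 := hA.det_pos
  have b0 := hB.det_pos
  have m0 := hMp.det_pos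
  set cA := (Real.sqrt (N * A.det))⁻¹ with hcA
  set cB := (Real.sqrt (N * B.det))⁻¹ with hcB
  have cA0 : 0 < cA := by positivity
  have cB0 : 0 < cB := by positivity
  have e : ∀ x, Real.sqrt (gaussDensity μ A x * gaussDensity μ B x)
      = Real.sqrt (cA * cB) * Real.exp (-((x - μ) ⬝ᵥ (M *ᵥ (x - μ))) / 2) := by
    intro x
    rw [Real.sqrt_eq_iff_mul_self_eq (mul_nonneg (gd_nonneg _ _ _) (gd_nonneg _ _ _))
      (by positivity)]
    unfold gaussDensity
    generalize x - μ = z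
    have h1 : z ⬝ᵥ (M *ᵥ z) = (z ⬝ᵥ (A⁻¹ *ᵥ z) + z ⬝ᵥ (B⁻¹ *ᵥ z)) / 2 := by
      rw [hM, Matrix.smul_mulVec, Matrix.add_mulVec, dotProduct_smul, dotProduct_add, smul_eq_mul]
      ring
    rw [h1, ← hN, ← hcA, ← hcB]
    have h2 : Real.sqrt (cA * cB) * Real.sqrt (cA * cB) = cA * cB :=
      Real.mul_self_sqrt (by positivity)
    have key : ∀ a b d : ℝ, a + b = 2 * d →
        Real.sqrt (cA * cB) * Real.exp d * (Real.sqrt (cA * cB) * Real.exp d)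
        = cA * Real.exp a * (cB * Real.exp b) := by
      intro a b d h
      have : Real.exp a * Real.exp b = Real.exp d * Real.exp d := by
        rw [← Real.exp_add, ← Real.exp_add, h]; ring_nf
      linear_combination (Real.exp d * Real.exp d) * h2 - cA * cB * this
    symm
    apply key
    ring
  simp_rw [e]
  rw [integral_const_mul,
    integral_sub_right_eq_self (fun x => Real.exp (-(x ⬝ᵥ (M *ᵥ x)) / 2)) μ, (gauss_int hMp).2]
  rw [← hN]
  have i1 := det_mul_le_exp hA.posSemidef hMp.posSemidef
  have i2 := det_mul_le_exp hB.posSemidef hMp.posSemidef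
  have uA : A * A⁻¹ = 1 := Matrix.mul_nonsing_inv _ a0.ne'.isUnit
  have uB : B * B⁻¹ = 1 := Matrix.mul_nonsing_inv _ b0.ne'.isUnit
  have tA : (A * M).trace = (Fintype.card ι + (A * B⁻¹).trace) / 2 := by
    rw [hM, Matrix.mul_smul, Matrix.mul_add, uA, Matrix.trace_smul, Matrix.trace_add,
      Matrix.trace_one, smul_eq_mul]; ring
  have tB : (B * M).trace = (Fintype.card ι + (B * A⁻¹).trace) / 2 := by
    rw [hM, Matrix.mul_smul, Matrix.mul_add, uB, Matrix.trace_smul, Matrix.trace_add,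
      Matrix.trace_one, smul_eq_mul]; ring
  have i3 : (A.det * M.det) * (B.det * M.det) ≤ Real.exp (T / 2) := by
    have := mul_le_mul i1 i2 (by positivity) (Real.exp_nonneg _)
    rw [← Real.exp_add] at this
    refine this.trans (le_of_eq ?_)
    congr 1
    rw [tA, tB, hT]; ring
  have h8 : 1 - T / 8 ≤ Real.exp (-T / 8) := by
    have := Real.add_one_le_exp (-T / 8); linarith
  refine h8.trans ?_
  refine le_of_pow_le_pow_left₀ (n := 4) (by norm_num) (by positivity) ?_
  have l1 : Real.exp (-T / 8) ^ 4 = (Real.exp (T / 2))⁻¹ := by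
    rw [← Real.exp_nat_mul, ← Real.exp_neg]; congr 1; push_cast; ring
  have l2 : (Real.sqrt (cA * cB) * Real.sqrt (N / M.det)) ^ 4
      = ((A.det * M.det) * (B.det * M.det))⁻¹ := by
    have q1 : Real.sqrt (cA * cB) ^ 2 = cA * cB := Real.sq_sqrt (by positivity)
    have q2 : Real.sqrt (N / M.det) ^ 2 = N / M.det := Real.sq_sqrt (by positivity)
    have q3 : cA ^ 2 = (N * A.det)⁻¹ := by rw [hcA, inv_pow, Real.sq_sqrt (by positivity)]
    have q4 : cB ^ 2 = (N * B.det)⁻¹ := by rw [hcB, inv_pow, Real.sq_sqrt (by positivity)]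
    calc _ = (Real.sqrt (cA * cB) ^ 2) ^ 2 * (Real.sqrt (N / M.det) ^ 2) ^ 2 := by ring
      _ = cA ^ 2 * cB ^ 2 * (N / M.det) ^ 2 := by rw [q1, q2]; ring
      _ = _ := by rw [q3, q4]; field_simp
  rw [l1, l2]
  exact inv_anti₀ (by positivity) i3

lemma gm_exp {S V : Matrix ι ι ℝ} (hS : S.PosDef) (hV : V.PosSemidef) :
    1 - (S * V).trace / 2 ≤ ∫ y, Real.exp (-(y ⬝ᵥ (V *ᵥ y)) / 2) ∂(gaussMeasure 0 S) := by
  have hM := hS.inv.add_posSemidef hV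
  have s0 := hS.det_pos
  have m0 := hM.det_pos
  unfold gaussMeasure
  rw [integral_withDensity_eq_integral_toReal_smul
    ((gd_cont 0 S).measurable.ennreal_ofReal) (by simp)]
  set N := (2 * Real.pi) ^ Fintype.card ι with hN
  have hNp : 0 < N := by positivity
  have e : ∀ y, (ENNReal.ofReal (gaussDensity 0 S y)).toReal • Real.exp (-(y ⬝ᵥ (V *ᵥ y)) / 2)
      = (Real.sqrt (N * S.det))⁻¹ * Real.exp (-(y ⬝ᵥ ((S⁻¹ + V) *ᵥ y)) / 2) := by
    intro y
    rw [ENNReal.toReal_ofReal (gd_nonneg _ _ _), smul_eq_mul]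
    unfold gaussDensity
    rw [mul_assoc, ← Real.exp_add, sub_zero, Matrix.add_mulVec, dotProduct_add]
    congr 2
    ring
  simp_rw [e]
  rw [integral_const_mul, (gauss_int hM).2, ← hN]
  have i1 := det_mul_le_exp hS.posSemidef hM.posSemidef
  rw [Matrix.mul_add, Matrix.mul_nonsing_inv _ s0.ne'.isUnit, Matrix.trace_add,
    Matrix.trace_one, add_sub_cancel_left] at i1
  have h8 : 1 - (S * V).trace / 2 ≤ Real.exp (-(S * V).trace / 2) := by
    have := Real.add_one_le_exp (-(S * V).trace / 2); linarith
  refine h8.trans ?_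
  refine le_of_pow_le_pow_left₀ (n := 2) (by norm_num) (by positivity) ?_
  have l1 : Real.exp (-(S * V).trace / 2) ^ 2 = (Real.exp ((S * V).trace))⁻¹ := by
    rw [← Real.exp_nat_mul, ← Real.exp_neg]; congr 1; push_cast; ring
  rw [l1, mul_pow, inv_pow, Real.sq_sqrt (by positivity), Real.sq_sqrt (by positivity)]
  have : (N * S.det)⁻¹ * (N / (S⁻¹ + V).det) = (S.det * (S⁻¹ + V).det)⁻¹ := by field_simp
  rw [this]
  exact inv_anti₀ (by positivity) i1

end GaussLemmas

section Core

variable {ι κ : Type*} [Fintype ι] [DecidableEq ι] [Fintype κ] [DecidableEq κ]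

lemma tv_nonneg {α : Type*} [MeasurableSpace α] (μ ν : Measure α) : 0 ≤ TVdist μ ν :=
  Real.iSup_nonneg fun _ => abs_nonneg _

lemma core [Nonempty ι] {S : Matrix κ κ ℝ} (hS : S.PosDef) (K : Matrix κ ι ℝ) {D : Matrix ι ι ℝ}
    (hDs : D.IsHermitian) (hD : (1 - D).PosSemidef) {A : Matrix ι ι ℝ}
    (hA : A = D - Kᵀ * S⁻¹ * K) {n : ℕ} (hn : 1 ≤ n) {t : ℝ} (ht : 0 < t)
    (htl : t ≤ lamMin A / Real.sqrt n) {q : ℝ} (hq : (Fintype.card ι : ℝ) ≤ q)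
    {α σ : ℝ} (hα : α = Real.exp (-t / 2)) (hσ : σ = Real.sqrt (1 - Real.exp (-t))) :
    (∫ y, TVdist (gaussMeasure (Kᵀ *ᵥ (S⁻¹ *ᵥ y)) A)
      (gaussMeasure (α • (Kᵀ *ᵥ (S⁻¹ *ᵥ y))) (α ^ 2 • A + σ ^ 2 • (1 : Matrix ι ι ℝ)))
      ∂(gaussMeasure 0 S)) ≤ 6 * Real.sqrt (q / n) := by
  have hnp : (0 : ℝ) < n := by exact_mod_cast hn
  have hsn : 0 < Real.sqrt n := Real.sqrt_pos.mpr hnp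
  have hSs : S⁻¹ᵀ = S⁻¹ := by simpa using hS.inv.isHermitian.eq
  set l := lamMin A with hl
  have hlp : 0 < l := by
    by_contra h
    have : l / Real.sqrt n ≤ 0 := div_nonpos_of_nonpos_of_nonneg (not_lt.mp h) hsn.le
    linarith
  have htl2 : t * Real.sqrt n ≤ l := (le_div_iff₀ hsn).mp htl
  have htl3 : (t / l) ^ 2 ≤ 1 / n := by
    rw [div_pow, div_le_div_iff₀ (by positivity) hnp, one_mul]
    calc t ^ 2 * n = (t * Real.sqrt n) ^ 2 := by rw [mul_pow, Real.sq_sqrt hnp.le]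
      _ ≤ l ^ 2 := by gcongr
  set C := Kᵀ * S⁻¹ * K with hC
  have hCp : C.PosSemidef := psd_conj hS.inv.posSemidef K
  have hAs : A.IsHermitian := by rw [hA]; exact hDs.sub hCp.isHermitian
  have hAl : (A - l • (1 : Matrix ι ι ℝ)).PosSemidef := psd_of_lamMin hAs hlp
  have hAp : A.PosDef := posDef_of_sub hlp hAl
  have hA1 : (1 - A).PosSemidef := by
    have : 1 - A = (1 - D) + C := by rw [hA]; abel
    rw [this]; exact hD.add hCp
  have hC1 : (1 - C).PosSemidef := by
    have : 1 - C = (1 - D) + A := by rw [hA]; abel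
    rw [this]; exact hD.add hAp.posSemidef
  have hm : (0 : ℝ) < Fintype.card ι := by exact_mod_cast Fintype.card_pos
  set m : ℝ := (Fintype.card ι : ℝ) with hmdef
  have hl1 : l ≤ 1 := by
    have a1 := hAl.trace_nonneg
    have a2 := hA1.trace_nonneg
    simp only [Matrix.trace_sub, Matrix.trace_smul, Matrix.trace_one, smul_eq_mul] at a1 a2
    rw [← hmdef] at a1 a2
    by_contra h
    nlinarith
  have hCt : C.trace ≤ m := by
    have a2 := hC1.trace_nonneg
    simp only [Matrix.trace_sub, Matrix.trace_one] at a2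
    linarith
  -- the diffused covariance
  set s := 1 - Real.exp (-t) with hs
  have hs0 : 0 ≤ s := by
    have : Real.exp (-t) ≤ 1 := Real.exp_le_one_iff.mpr (by linarith)
    linarith
  have hst : s ≤ t := by
    have := Real.add_one_le_exp (-t); linarith
  have hα2 : α ^ 2 = 1 - s := by
    rw [hα, ← Real.exp_nat_mul, hs, sub_sub_cancel]; congr 1; push_cast; ring
  have hσ2 : σ ^ 2 = s := by rw [hσ, Real.sq_sqrt hs0]
  set B := α ^ 2 • A + σ ^ 2 • (1 : Matrix ι ι ℝ) with hB
  have hB' : B = A + s • (1 - A) := by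
    rw [hB, hα2, hσ2, sub_smul, one_smul, smul_sub]; abel
  have hBp : B.PosDef := by rw [hB']; exact hAp.add_posSemidef (hA1.smul hs0)
  have htr := trace_bound hlp hs0 hAl hA1 hB'
  have htr2 : (s / l) ^ 2 * m ≤ m / n := by
    calc (s / l) ^ 2 * m ≤ (t / l) ^ 2 * m := by gcongr
      _ ≤ 1 / n * m := by gcongr
      _ = m / n := by ring
  -- the quadratic form of the mean shift
  set G := Kᵀ * S⁻¹ with hG
  have hGt : Gᵀ = S⁻¹ * K := by rw [hG, Matrix.transpose_mul, hSs, Matrix.transpose_transpose]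
  set V := ((1 - α) ^ 2 / 4) • (Gᵀ * A⁻¹ * G) with hV
  have hVp : V.PosSemidef := (psd_conj hAp.inv.posSemidef G).smul (by positivity)
  have hαt : (1 - α) ^ 2 ≤ t ^ 2 / 4 := by
    have a1 : 1 - α ≤ t / 2 := by
      have := Real.add_one_le_exp (-t / 2); rw [hα]; linarith
    have a2 : 0 ≤ 1 - α := by
      have : Real.exp (-t / 2) ≤ 1 := Real.exp_le_one_iff.mpr (by linarith)
      rw [hα]; linarith
    nlinarith
  have hSV : (S * V).trace ≤ m / n := by
    have e1 : (S * V).trace = (1 - α) ^ 2 / 4 * (C * A⁻¹).trace := by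
      have : S * (Gᵀ * A⁻¹ * G) = K * A⁻¹ * G := by
        have h0 : S * Gᵀ = K := by
          rw [hGt, ← Matrix.mul_assoc, Matrix.mul_nonsing_inv _ hS.det_pos.ne'.isUnit,
            Matrix.one_mul]
        conv_rhs => rw [← h0]
        simp only [Matrix.mul_assoc]
      rw [hV, Matrix.mul_smul, Matrix.trace_smul, smul_eq_mul, this,
        Matrix.trace_mul_comm, ← Matrix.mul_assoc]
    have e2 := trace_inv_le hlp hAl hCp
    have e3 : (C * A⁻¹).trace ≤ l⁻¹ * m := e2.trans (by gcongr)
    rw [e1]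
    calc (1 - α) ^ 2 / 4 * (C * A⁻¹).trace ≤ (t ^ 2 / 4) / 4 * (l⁻¹ * m) := by
          have e4 := trace_mul_nonneg_psd hCp hAp.inv.posSemidef
          gcongr
      _ = (t / l) ^ 2 * (l * m) / 16 := by field_simp; norm_num
      _ ≤ (1 / n) * (1 * m) / 16 := by gcongr
      _ ≤ m / n := by
          have : 0 ≤ m / n := by positivity
          have e : 1 / (n : ℝ) * (1 * m) / 16 = m / n / 16 := by ring
          rw [e]; linarith
  have hqf : ∀ y : κ → ℝ, -((Kᵀ *ᵥ (S⁻¹ *ᵥ y) - α • (Kᵀ *ᵥ (S⁻¹ *ᵥ y))) ⬝ᵥ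
      (A⁻¹ *ᵥ (Kᵀ *ᵥ (S⁻¹ *ᵥ y) - α • (Kᵀ *ᵥ (S⁻¹ *ᵥ y))))) / 8 = -(y ⬝ᵥ (V *ᵥ y)) / 2 := by
    intro y
    have e1 : Kᵀ *ᵥ (S⁻¹ *ᵥ y) = G *ᵥ y := by rw [hG, Matrix.mulVec_mulVec]
    have e2 : G *ᵥ y - α • (G *ᵥ y) = (1 - α) • (G *ᵥ y) := by rw [sub_smul, one_smul]
    have e3 : y ⬝ᵥ ((Gᵀ * A⁻¹ * G) *ᵥ y) = (G *ᵥ y) ⬝ᵥ (A⁻¹ *ᵥ (G *ᵥ y)) := by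
      rw [← Matrix.mulVec_mulVec, ← Matrix.mulVec_mulVec, Matrix.dotProduct_mulVec,
        Matrix.vecMul_transpose]
    rw [e1, e2, hV, Matrix.smul_mulVec, dotProduct_smul, e3, Matrix.mulVec_smul, smul_dotProduct,
      dotProduct_smul]
    simp only [smul_eq_mul]
    ring
  have hqp : 0 < q := lt_of_lt_of_le hm hq
  set k := Real.sqrt (q / n) with hk
  have hkp : 0 < k := Real.sqrt_pos.mpr (by positivity)
  have hk2 : k ^ 2 = q / n := Real.sq_sqrt (by positivity)
  have hmk : m / n ≤ k ^ 2 := by rw [hk2]; gcongr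
  have hpt : ∀ y : κ → ℝ, TVdist (gaussMeasure (Kᵀ *ᵥ (S⁻¹ *ᵥ y)) A)
      (gaussMeasure (α • (Kᵀ *ᵥ (S⁻¹ *ᵥ y))) B)
      ≤ (1 - Real.exp (-(y ⬝ᵥ (V *ᵥ y)) / 2)) / k + 5 * k := by
    intro y
    have : Nonempty {s : Set (ι → ℝ) // MeasurableSet s} := ⟨⟨∅, MeasurableSet.empty⟩⟩
    refine ciSup_le fun u => ?_
    have b1 := tv_set (Kᵀ *ᵥ (S⁻¹ *ᵥ y)) (α • (Kᵀ *ᵥ (S⁻¹ *ᵥ y))) hAp hAp hkp u.2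
    have b2 := tv_set (α • (Kᵀ *ᵥ (S⁻¹ *ᵥ y))) (α • (Kᵀ *ᵥ (S⁻¹ *ᵥ y))) hAp hBp hkp u.2
    rw [bc_same_cov _ _ hAp, hqf y] at b1
    have b3 := bc_same_mean (α • (Kᵀ *ᵥ (S⁻¹ *ᵥ y))) hAp hBp
    have b4 : (1 - ∫ x, Real.sqrt (gaussDensity (α • (Kᵀ *ᵥ (S⁻¹ *ᵥ y))) A x
        * gaussDensity (α • (Kᵀ *ᵥ (S⁻¹ *ᵥ y))) B x)) / k ≤ k := by
      rw [div_le_iff₀ hkp]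
      nlinarith [sq_nonneg k]
    refine (abs_sub_le _ (gaussMeasure (α • (Kᵀ *ᵥ (S⁻¹ *ᵥ y))) A u.1).toReal _).trans ?_
    linarith
  have hprob : IsProbabilityMeasure (gaussMeasure 0 S) := gm_prob 0 hS
  have hint : Integrable (fun y : κ → ℝ => Real.exp (-(y ⬝ᵥ (V *ᵥ y)) / 2)) (gaussMeasure 0 S) := by
    refine (integrable_const (1 : ℝ)).mono' ?_ (Filter.Eventually.of_forall fun y => ?_)
    · exact Continuous.aestronglyMeasurable (by fun_prop)
    · rw [Real.norm_of_nonneg (Real.exp_nonneg _)]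
      apply Real.exp_le_one_iff.mpr
      have := hVp.dotProduct_mulVec_nonneg y
      simp only [star_trivial] at this
      linarith
  have hint2 := ((integrable_const (1 : ℝ)).sub hint).div_const k
  have hE := gm_exp hS hVp
  calc _ ≤ ∫ y, ((1 - Real.exp (-(y ⬝ᵥ (V *ᵥ y)) / 2)) / k + 5 * k) ∂(gaussMeasure 0 S) :=
        integral_mono_of_nonneg (Filter.Eventually.of_forall fun y => tv_nonneg _ _)
          (hint2.add (integrable_const (5 * k))) (Filter.Eventually.of_forall hpt)
    _ = (1 - ∫ y, Real.exp (-(y ⬝ᵥ (V *ᵥ y)) / 2) ∂(gaussMeasure 0 S)) / k + 5 * k := by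
        have h2 : Integrable (fun y : κ → ℝ => (1 - Real.exp (-(y ⬝ᵥ (V *ᵥ y)) / 2)) / k)
          (gaussMeasure 0 S) := hint2
        rw [integral_add h2 (integrable_const _), integral_div,
          integral_sub (integrable_const _) hint]
        simp
    _ ≤ k + 5 * k := by
        gcongr
        rw [div_le_iff₀ hkp]
        nlinarith [sq_nonneg k]
    _ = 6 * k := by ring

end Core

/-- there are absolute constants `c > 0` and `n₀ ≥ 1` such that, for
`λ_max(Γ) ≤ 1`, `λ_max(Λ) ≤ 1`, `n ≥ n₀` and early-stopping time
`0 < t₀ ≤ λ_min(Σ_cond)·n^{-1/2}`, the expected total variation distance between the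
true conditional law `N(μ_cond(y), Σ_cond)` and its OU-diffusion at time `t₀`, over
`y ~ N(0, Σ_obs)`, is at most `c√(Hd/n)`. -/
theorem early_stopping_tv_bound :
    ∃ c : ℝ, 0 < c ∧ ∃ n₀ : ℕ, 1 ≤ n₀ ∧
    ∀ (H d : ℕ), 2 ≤ H → 1 ≤ d →
    ∀ (Γ : Matrix (Fin H) (Fin H) ℝ) (Λ : Matrix (Fin d) (Fin d) ℝ),
      Γ.PosDef → Λ.PosDef →
    ∀ (Iobs Imiss : Finset (Fin H)), Iobs.Nonempty → Imiss.Nonempty →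
      Disjoint Iobs Imiss → Iobs ∪ Imiss = Finset.univ →
    lamMax Γ ≤ 1 → lamMax Λ ≤ 1 →
    let Γobs : Matrix {i // i ∈ Iobs} {i // i ∈ Iobs} ℝ :=
      Γ.submatrix (fun i => (i : Fin H)) (fun i => (i : Fin H))
    let Γmiss : Matrix {i // i ∈ Imiss} {i // i ∈ Imiss} ℝ :=
      Γ.submatrix (fun i => (i : Fin H)) (fun i => (i : Fin H))
    let Γcor : Matrix {i // i ∈ Iobs} {i // i ∈ Imiss} ℝ :=
      Γ.submatrix (fun i => (i : Fin H)) (fun i => (i : Fin H))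
    let Sobs : Matrix ({i // i ∈ Iobs} × Fin d) ({i // i ∈ Iobs} × Fin d) ℝ := Γobs ⊗ₖ Λ
    let Smiss : Matrix ({i // i ∈ Imiss} × Fin d) ({i // i ∈ Imiss} × Fin d) ℝ := Γmiss ⊗ₖ Λ
    let Scor : Matrix ({i // i ∈ Iobs} × Fin d) ({i // i ∈ Imiss} × Fin d) ℝ := Γcor ⊗ₖ Λ
    let Scond : Matrix ({i // i ∈ Imiss} × Fin d) ({i // i ∈ Imiss} × Fin d) ℝ :=
      Smiss - Scor.transpose * Sobs⁻¹ * Scor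
    let μcond : ({i // i ∈ Iobs} × Fin d → ℝ) → ({i // i ∈ Imiss} × Fin d → ℝ) :=
      fun y => Scor.transpose *ᵥ (Sobs⁻¹ *ᵥ y)
    ∀ n : ℕ, n₀ ≤ n →
    ∀ t₀ : ℝ, 0 < t₀ → t₀ ≤ lamMin Scond / Real.sqrt n →
    let α₀ : ℝ := Real.exp (-t₀/2)
    let σ₀ : ℝ := Real.sqrt (1 - Real.exp (-t₀))
    (∫ y, TVdist (gaussMeasure (μcond y) Scond)
        (gaussMeasure (α₀ • μcond y)
          (α₀^2 • Scond + σ₀^2 •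
            (1 : Matrix ({i // i ∈ Imiss} × Fin d) ({i // i ∈ Imiss} × Fin d) ℝ)))
      ∂(gaussMeasure (0 : {i // i ∈ Iobs} × Fin d → ℝ) Sobs)) ≤
      c * Real.sqrt ((H : ℝ) * d / n) := by
  refine ⟨6, by norm_num, 1, le_rfl, ?_⟩
  intro H d hH hd Γ Λ hΓ hΛ Iobs Imiss hIo hIm hdisj hun hmΓ hmΛ
  intro Γobs Γmiss Γcor Sobs Smiss Scor Scond μcond n hn t₀ ht htl α₀ σ₀
  have hΓ1 : (1 - Γ).PosSemidef := psd_of_lamMax hΓ.isHermitian hmΓ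
  have hΛ1 : (1 - Λ).PosSemidef := psd_of_lamMax hΛ.isHermitian hmΛ
  have hΓo : Γobs.PosDef := hΓ.submatrix Subtype.val_injective
  have hΓm : Γmiss.PosDef := hΓ.submatrix Subtype.val_injective
  have hΓm1 : (1 - Γmiss).PosSemidef := by
    have h := hΓ1.submatrix (fun i : {i // i ∈ Imiss} => (i : Fin H))
    have e : (1 - Γ).submatrix (fun i : {i // i ∈ Imiss} => (i : Fin H))
        (fun i : {i // i ∈ Imiss} => (i : Fin H))
        = 1 - Γmiss := by
      ext i j
      by_cases hij : i = j
      · subst hij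
        simp [Γmiss]
      · have hij' : (i : Fin H) ≠ j := fun h => hij (Subtype.ext h)
        simp [Γmiss, Matrix.one_apply_ne hij, Matrix.one_apply_ne hij']
    rwa [e] at h
  have hSo : Sobs.PosDef := hΓo.kronecker hΛ
  have hSm : Smiss.PosDef := hΓm.kronecker hΛ
  have hSm1 : (1 - Smiss).PosSemidef := by
    have h1 := hΓm1.kronecker (Matrix.PosSemidef.one (n := Fin d) (R := ℝ))
    have h2 := hΓm.posSemidef.kronecker hΛ1
    have e : (1 - Smiss) = (1 - Γmiss) ⊗ₖ (1 : Matrix (Fin d) (Fin d) ℝ)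
        + Γmiss ⊗ₖ (1 - Λ) := by
      have e1 : (1 : Matrix ({i // i ∈ Imiss} × Fin d) ({i // i ∈ Imiss} × Fin d) ℝ)
          = (1 : Matrix {i // i ∈ Imiss} {i // i ∈ Imiss} ℝ) ⊗ₖ (1 : Matrix (Fin d) (Fin d) ℝ) :=
        Matrix.one_kronecker_one.symm
      rw [e1]
      ext ⟨i, a⟩ ⟨j, b⟩
      simp only [Smiss, Matrix.sub_apply, Matrix.add_apply, Matrix.kronecker_apply]
      ring
    rw [e]; exact h1.add h2
  have : Nonempty ({i // i ∈ Imiss} × Fin d) := by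
    obtain ⟨i, hi⟩ := hIm
    exact ⟨⟨⟨i, hi⟩, ⟨0, by omega⟩⟩⟩
  have hq : (Fintype.card ({i // i ∈ Imiss} × Fin d) : ℝ) ≤ (H : ℝ) * d := by
    rw [Fintype.card_prod, Fintype.card_coe, Fintype.card_fin]
    push_cast
    gcongr
    simpa using Finset.card_le_univ Imiss
  exact core hSo Scor hSm.isHermitian hSm1 (A := Scond) rfl hn ht htl hq rfl rfl

end
end

section
/- Write m₁ = d|I_miss|, let ξ₁, …, ξ_{m₁} be the eigenvalues of Σ_cond, fix t₀ > 0 and set α = e^(−t₀/2), σ² = 1 − e^(−t₀), and, for y ∈ ℝ^(d|I_obs|), μ_cond(y) = Σ_corᵀ Σ_obs^(−1) y. Then for y ~ N(0, Σ_obs): E_y[ KL( N(α·μ_cond(y), α²Σ_cond + σ²I_{m₁}) ‖ N(μ_cond(y), Σ_cond) ) ] = (1/2)·[ Σ_{i=1}^{m₁}(α² + σ²ξ_i^(−1)) − Σ_{i=1}^{m₁} log(α² + σ²ξ_i^(−1)) − m₁ + (1−α)²·tr(Σ_corᵀ Σ_obs^(−1) Σ_cor Σ_cond^(−1)) ], where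 KL denotes the Kullback–Leibler divergence. -/
open Matrix MeasureTheory
open scoped Kronecker BigOperators

noncomputable section

/-- Kullback–Leibler divergence `KL(μ ‖ ν) = ∫ log (dμ/dν) dμ`. -/
def KLdiv {α : Type*} [MeasurableSpace α] (μ ν : Measure α) : ℝ :=
  ∫ x, Real.log ((μ.rnDeriv ν) x).toReal ∂μ


open ProbabilityTheory

lemma aux_measurable_gaussDensity {ι : Type*} [Fintype ι] [DecidableEq ι]
    (μ : ι → ℝ) (S : Matrix ι ι ℝ) : Measurable (gaussDensity μ S) := by
  have : Continuous (gaussDensity μ S) := by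
    unfold gaussDensity
    fun_prop
  exact this.measurable

lemma aux_gaussDensity_pos {ι : Type*} [Fintype ι] [DecidableEq ι]
    (μ : ι → ℝ) (S : Matrix ι ι ℝ) (hS : 0 < S.det) (x : ι → ℝ) : 0 < gaussDensity μ S x := by
  unfold gaussDensity
  positivity

lemma aux_std {ι : Type*} [Fintype ι] [DecidableEq ι] :
    gaussMeasure (0 : ι → ℝ) 1 = Measure.pi (fun _ : ι => gaussianReal 0 1) := by
  refine (Measure.pi_eq fun s hs => ?_).symm
  have hd : ∀ x : ι → ℝ, gaussDensity 0 1 x = ∏ i, gaussianPDFReal 0 1 (x i) := by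
    intro x
    simp only [gaussDensity, gaussianPDFReal, Finset.prod_mul_distrib, ← Real.exp_sum]
    congr 1
    · rw [Matrix.det_one, mul_one, Finset.prod_const, inv_pow]
      congr 1
      rw [Real.sqrt_eq_iff_mul_self_eq (by positivity) (by positivity), ← mul_pow,
        Real.mul_self_sqrt (by positivity)]
      simp
    · simp [dotProduct, Finset.sum_div, ← Finset.sum_neg_distrib, pow_two, neg_div]
  rw [gaussMeasure, withDensity_apply _ (MeasurableSet.univ_pi hs), volume_pi,
    Measure.restrict_pi_pi]
  simp only [hd]
  rw [← ofReal_integral_eq_lintegral_ofReal, integral_fintype_prod_eq_prod,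
    ENNReal.ofReal_prod_of_nonneg]
  · refine Finset.prod_congr rfl fun i _ => ?_
    rw [gaussianReal_apply_eq_integral _ one_ne_zero]
  · intro i _
    exact integral_nonneg fun x => gaussianPDFReal_nonneg _ _ _
  · exact Integrable.fintype_prod fun i => (integrable_gaussianPDFReal 0 1).restrict
  · exact Filter.Eventually.of_forall fun x =>
      Finset.prod_nonneg fun i _ => gaussianPDFReal_nonneg _ _ _

lemma aux_dens {ι : Type*} [Fintype ι] [DecidableEq ι]
    (μ : ι → ℝ) (S B : Matrix ι ι ℝ) (hB : B.det ≠ 0) (hS : B * Bᵀ = S) (z : ι → ℝ) :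
    |B.det| * gaussDensity μ S (μ + B *ᵥ z) = gaussDensity 0 1 z := by
  have hu : IsUnit B.det := isUnit_iff_ne_zero.mpr hB
  subst hS
  have h1 : (B *ᵥ z) ⬝ᵥ ((B * Bᵀ)⁻¹ *ᵥ (B *ᵥ z)) = z ⬝ᵥ z := by
    rw [Matrix.mul_inv_rev, ← Matrix.mulVec_mulVec, Matrix.mulVec_mulVec z,
      Matrix.nonsing_inv_mul _ hu, Matrix.one_mulVec, Matrix.dotProduct_mulVec,
      ← Matrix.transpose_nonsing_inv, Matrix.vecMul_transpose, Matrix.mulVec_mulVec,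
      Matrix.nonsing_inv_mul _ hu, Matrix.one_mulVec]
  have h2 : √((2 * Real.pi) ^ Fintype.card ι * (B * Bᵀ).det)
      = √((2 * Real.pi) ^ Fintype.card ι) * |B.det| := by
    rw [Real.sqrt_mul (by positivity), Matrix.det_mul, Matrix.det_transpose, Real.sqrt_mul_self_eq_abs]
  have h3 : |B.det| ≠ 0 := abs_ne_zero.mpr hB
  simp only [gaussDensity, add_sub_cancel_left, h1, h2]
  simp
  field_simp

lemma aux_map {ι : Type*} [Fintype ι] [DecidableEq ι]
    (μ : ι → ℝ) (S B : Matrix ι ι ℝ) (hB : B.det ≠ 0) (hS : B * Bᵀ = S) :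
    gaussMeasure μ S = (gaussMeasure 0 1).map (fun z => μ + B *ᵥ z) := by
  have hm : Measurable (fun z : ι → ℝ => μ + B *ᵥ z) := by
    have : Continuous (fun z : ι → ℝ => μ + B *ᵥ z) := by fun_prop
    exact this.measurable
  have hmB : Measurable (fun z : ι → ℝ => B *ᵥ z) := by
    have : Continuous (fun z : ι → ℝ => B *ᵥ z) := by fun_prop
    exact this.measurable
  have hv : (volume : Measure (ι → ℝ)).map (fun z => μ + B *ᵥ z)
      = ENNReal.ofReal |B.det|⁻¹ • volume := by
    have h1 := Real.map_matrix_volume_pi_eq_smul_volume_pi hB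
    have h2 : (fun z : ι → ℝ => μ + B *ᵥ z) = (fun z => μ + z) ∘ (toLin' B) := by
      ext z; simp
    have hmT : Measurable (toLin' B) := hmB
    rw [h2, ← Measure.map_map (by fun_prop) hmT, h1, Measure.map_smul,
      map_add_left_eq_self, abs_inv]
  have hv2 : (volume : Measure (ι → ℝ)) =
      ENNReal.ofReal |B.det| • (volume : Measure (ι → ℝ)).map (fun z => μ + B *ᵥ z) := by
    rw [hv, smul_smul, ← ENNReal.ofReal_mul (abs_nonneg _), mul_inv_cancel₀ (abs_ne_zero.mpr hB)]
    simp
  have hmd : Measurable (fun z : ι → ℝ => ENNReal.ofReal (gaussDensity μ S (μ + B *ᵥ z))) :=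
    (aux_measurable_gaussDensity μ S).ennreal_ofReal.comp hm
  ext s hs
  rw [Measure.map_apply hm hs, gaussMeasure, gaussMeasure, withDensity_apply _ hs,
    withDensity_apply _ (hm hs)]
  conv_lhs => rw [hv2]
  rw [Measure.restrict_smul, lintegral_smul_measure,
    setLIntegral_map hs (aux_measurable_gaussDensity _ _).ennreal_ofReal hm, smul_eq_mul,
    ← lintegral_const_mul _ hmd]
  refine lintegral_congr fun z => ?_
  rw [← ENNReal.ofReal_mul (abs_nonneg _), aux_dens μ S B hB hS]

lemma aux_fact {ι : Type*} [Fintype ι] [DecidableEq ι] (S : Matrix ι ι ℝ) (hS : S.PosDef) :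
    ∃ B : Matrix ι ι ℝ, B.det ≠ 0 ∧ B * Bᵀ = S := by
  have : ∃ B : Matrix ι ι ℝ, S = Bᴴ * B := by
    open scoped MatrixOrder in
    exact CStarAlgebra.nonneg_iff_eq_star_mul_self.mp hS.posSemidef.nonneg
  obtain ⟨B, rfl⟩ := this
  refine ⟨Bᵀ, ?_, by simp [Matrix.conjTranspose_eq_transpose_of_trivial]⟩
  intro h
  have := hS.det_pos
  rw [Matrix.det_mul] at this
  simp at h
  simp [h] at this

lemma aux_prob {ι : Type*} [Fintype ι] [DecidableEq ι] (μ : ι → ℝ) (S : Matrix ι ι ℝ)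
    (hS : S.PosDef) : IsProbabilityMeasure (gaussMeasure μ S) := by
  obtain ⟨B, hB, h⟩ := aux_fact S hS
  rw [aux_map μ S B hB h, aux_std]
  refine Measure.isProbabilityMeasure_map (Continuous.aemeasurable ?_)
  fun_prop

lemma aux_moment {ι : Type*} [Fintype ι] [DecidableEq ι] (i j : ι) :
    Integrable (fun z : ι → ℝ => z i * z j) (Measure.pi (fun _ : ι => gaussianReal 0 1)) ∧
    ∫ z, z i * z j ∂(Measure.pi (fun _ : ι => gaussianReal 0 1)) = if i = j then 1 else 0 := by
  have hL : MemLp (id : ℝ → ℝ) 2 (gaussianReal 0 1) := memLp_id_gaussianReal' 2 (by simp)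
  have hL' : ∀ i : ι, MemLp (fun z : ι → ℝ => z i) 2 (Measure.pi (fun _ : ι => gaussianReal 0 1)) :=
    fun i => hL.comp_measurePreserving (measurePreserving_eval _ i)
  refine ⟨(hL' i).integrable_mul (hL' j), ?_⟩
  split_ifs with h
  · subst h
    have := integral_comp_eval (μ := fun _ : ι => gaussianReal 0 1) (i := i)
      (f := fun x : ℝ => x * x) (by fun_prop)
    rw [this]
    have hv := variance_fun_id_gaussianReal (μ := 0) (v := 1)
    rw [variance_eq_integral measurable_id'.aemeasurable] at hv
    simpa [pow_two] using hv
  · have hi := (iIndepFun_pi (μ := fun _ : ι => gaussianReal 0 1) (X := fun _ x => x)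
      (fun i => aemeasurable_id)).indepFun h
    have := hi.integral_mul_eq_mul_integral (hL' i).1 (hL' j).1
    simp only [Pi.mul_apply] at this
    refine this.trans ?_
    rw [integral_eval]
    simp

lemma aux_lin {ι : Type*} [Fintype ι] [DecidableEq ι] (i : ι) :
    Integrable (fun z : ι → ℝ => z i) (Measure.pi (fun _ : ι => gaussianReal 0 1)) ∧
    ∫ z, z i ∂(Measure.pi (fun _ : ι => gaussianReal 0 1)) = 0 := by
  have hL : MemLp (id : ℝ → ℝ) 1 (gaussianReal 0 1) := memLp_id_gaussianReal' 1 (by simp)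
  refine ⟨integrable_eval (memLp_one_iff_integrable.mp hL), ?_⟩
  rw [integral_eval]; simp

/-- Quadratic forms of a Gaussian vector. -/
lemma aux_quad {ι : Type*} [Fintype ι] [DecidableEq ι] (μ m : ι → ℝ) (S A : Matrix ι ι ℝ)
    (hS : S.PosDef) :
    Integrable (fun x => (x - m) ⬝ᵥ (A *ᵥ (x - m))) (gaussMeasure μ S) ∧
    ∫ x, (x - m) ⬝ᵥ (A *ᵥ (x - m)) ∂(gaussMeasure μ S)
      = (A * S).trace + (μ - m) ⬝ᵥ (A *ᵥ (μ - m)) := by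
  obtain ⟨B, hB, h⟩ := aux_fact S hS
  rw [aux_map μ S B hB h, aux_std]
  have hm : Continuous (fun z : ι → ℝ => μ + B *ᵥ z) := by fun_prop
  have hq : Continuous (fun x : ι → ℝ => (x - m) ⬝ᵥ (A *ᵥ (x - m))) := by fun_prop
  set P := Measure.pi (fun _ : ι => gaussianReal 0 1) with hP
  set c := μ - m with hc
  set M := Bᵀ * A * B with hM
  set w := Bᵀ *ᵥ (A *ᵥ c) + Bᵀ *ᵥ (Aᵀ *ᵥ c) with hw
  have hexp : ∀ z : ι → ℝ, (μ + B *ᵥ z - m) ⬝ᵥ (A *ᵥ (μ + B *ᵥ z - m))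
      = c ⬝ᵥ (A *ᵥ c) + (∑ i, w i * z i + ∑ i, ∑ j, M i j * (z i * z j)) := by
    intro z
    have e1 : μ + B *ᵥ z - m = c + B *ᵥ z := by rw [hc]; abel
    have e2 : ∑ i, w i * z i = (B *ᵥ z) ⬝ᵥ (A *ᵥ c) + c ⬝ᵥ (A *ᵥ (B *ᵥ z)) := by
      change w ⬝ᵥ z = _
      rw [hw, add_dotProduct, dotProduct_comm (B *ᵥ z), Matrix.dotProduct_mulVec _ B,
        Matrix.dotProduct_mulVec c A, Matrix.dotProduct_mulVec _ B, Matrix.mulVec_transpose,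
        Matrix.mulVec_transpose, Matrix.mulVec_transpose]
    have e3 : ∑ i, ∑ j, M i j * (z i * z j) = (B *ᵥ z) ⬝ᵥ (A *ᵥ (B *ᵥ z)) := by
      have : z ⬝ᵥ (M *ᵥ z) = (B *ᵥ z) ⬝ᵥ (A *ᵥ (B *ᵥ z)) := by
        rw [hM, ← Matrix.mulVec_mulVec, ← Matrix.mulVec_mulVec, Matrix.dotProduct_mulVec z,
          Matrix.vecMul_transpose]
      rw [← this]
      simp only [dotProduct, mulVec, Finset.mul_sum]
      refine Finset.sum_congr rfl fun i _ => Finset.sum_congr rfl fun j _ => by ring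
    rw [e1, e2, e3, Matrix.mulVec_add, add_dotProduct, dotProduct_add, dotProduct_add]
    ring
  have i1 : Integrable (fun z : ι → ℝ => ∑ i, w i * z i) P :=
    integrable_finsetSum _ fun i _ => (aux_lin i).1.const_mul _
  have i2 : Integrable (fun z : ι → ℝ => ∑ i, ∑ j, M i j * (z i * z j)) P :=
    integrable_finsetSum _ fun i _ => integrable_finsetSum _ fun j _ =>
      (aux_moment i j).1.const_mul _
  constructor
  · rw [integrable_map_measure hq.aestronglyMeasurable hm.aemeasurable]
    refine ((integrable_const (c ⬝ᵥ (A *ᵥ c))).add (i1.add i2)).congr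
      (Filter.Eventually.of_forall fun z => ?_)
    simp only [Function.comp_apply, hexp, Pi.add_apply]
  · rw [integral_map hm.aemeasurable hq.aestronglyMeasurable]
    simp only [hexp]
    have i12 : Integrable (fun z : ι → ℝ => ∑ i, w i * z i + ∑ i, ∑ j, M i j * (z i * z j)) P :=
      i1.add i2
    have s1 : ∫ z, ∑ i, w i * z i ∂P = 0 := by
      rw [integral_finsetSum _ fun i _ => (aux_lin i).1.const_mul _]
      simp only [integral_const_mul, (aux_lin _).2]
      simp
    have s2 : ∀ i, ∫ z, ∑ j, M i j * (z i * z j) ∂P = M i i := by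
      intro i
      rw [integral_finsetSum _ fun j _ => (aux_moment i j).1.const_mul _]
      simp only [integral_const_mul, (aux_moment _ _).2]
      simp
    have s3 : ∫ z, ∑ i, ∑ j, M i j * (z i * z j) ∂P = M.trace := by
      have hi : ∀ i ∈ Finset.univ, Integrable (fun z : ι → ℝ => ∑ j, M i j * (z i * z j)) P :=
        fun i _ => integrable_finsetSum _ fun j _ => (aux_moment i j).1.const_mul _
      refine (integral_finsetSum _ hi).trans ?_
      exact Finset.sum_congr rfl fun i _ => s2 i
    have ht : (A * S).trace = M.trace := by
      rw [hM, ← h, ← Matrix.mul_assoc, Matrix.trace_mul_comm, Matrix.mul_assoc]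
    rw [integral_add (integrable_const _) i12, integral_add i1 i2, integral_const, s1, s3, ht]
    simp [add_comm]

lemma aux_KL {ι : Type*} [Fintype ι] [DecidableEq ι] (μ m : ι → ℝ) (S T : Matrix ι ι ℝ)
    (hS : S.PosDef) (hT : T.PosDef) :
    KLdiv (gaussMeasure μ S) (gaussMeasure m T)
      = (1/2) * ((T⁻¹ * S).trace + (Real.log T.det - Real.log S.det) - (Fintype.card ι : ℝ)
        + (μ - m) ⬝ᵥ (T⁻¹ *ᵥ (μ - m))) := by
  have hSp := aux_prob μ S hS
  have hTp := aux_prob m T hT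
  have hac : gaussMeasure μ S ≪ volume := withDensity_absolutelyContinuous _ _
  have hSd := hS.det_pos
  have hTd := hT.det_pos
  have hrn : ∀ᵐ x ∂(gaussMeasure μ S),
      Real.log (((gaussMeasure μ S).rnDeriv (gaussMeasure m T)) x).toReal
      = (1/2) * (Real.log T.det - Real.log S.det)
        + ((1/2) * ((x - m) ⬝ᵥ (T⁻¹ *ᵥ (x - m))) - (1/2) * ((x - μ) ⬝ᵥ (S⁻¹ *ᵥ (x - μ)))) := by
    refine hac.ae_le ?_
    have h1 := Measure.rnDeriv_withDensity_right (gaussMeasure μ S) volume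
      (f := fun x => ENNReal.ofReal (gaussDensity m T x))
      (aux_measurable_gaussDensity m T).ennreal_ofReal.aemeasurable
      (Filter.Eventually.of_forall fun x => by
        simpa using aux_gaussDensity_pos m T hTd x)
      (Filter.Eventually.of_forall fun x => ENNReal.ofReal_ne_top)
    have h2 : (gaussMeasure μ S).rnDeriv volume =ᵐ[volume] _ :=
      Measure.rnDeriv_withDensity volume
        (aux_measurable_gaussDensity μ S).ennreal_ofReal
    filter_upwards [h1, h2] with x hx1 hx2
    have hx3 : (gaussMeasure μ S).rnDeriv (gaussMeasure m T) x = _ := hx1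
    rw [hx3, hx2, ENNReal.toReal_mul, ENNReal.toReal_inv,
      ENNReal.toReal_ofReal (aux_gaussDensity_pos m T hTd x).le,
      ENNReal.toReal_ofReal (aux_gaussDensity_pos μ S hSd x).le,
      Real.log_mul (inv_ne_zero (aux_gaussDensity_pos m T hTd x).ne')
        (aux_gaussDensity_pos μ S hSd x).ne', Real.log_inv]
    have hlog : ∀ (ν : ι → ℝ) (R : Matrix ι ι ℝ), 0 < R.det → Real.log (gaussDensity ν R x)
        = -(1/2) * (Real.log ((2 * Real.pi) ^ (Fintype.card ι)) + Real.log R.det)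
          - (1/2) * ((x - ν) ⬝ᵥ (R⁻¹ *ᵥ (x - ν))) := by
      intro ν R hR
      unfold gaussDensity
      rw [Real.log_mul (by positivity) (by positivity), Real.log_inv, Real.log_exp,
        Real.log_sqrt (by positivity), Real.log_mul (by positivity) (by positivity)]
      ring
    rw [hlog m T hTd, hlog μ S hSd]
    ring
  obtain ⟨i1, e1⟩ := aux_quad μ m S T⁻¹ hS
  obtain ⟨i2, e2⟩ := aux_quad μ μ S S⁻¹ hS
  unfold KLdiv
  have i12 : Integrable (fun x => (1/2) * ((x - m) ⬝ᵥ (T⁻¹ *ᵥ (x - m)))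
      - (1/2) * ((x - μ) ⬝ᵥ (S⁻¹ *ᵥ (x - μ)))) (gaussMeasure μ S) :=
    (i1.const_mul _).sub (i2.const_mul _)
  rw [integral_congr_ae hrn, integral_add (integrable_const _) i12,
    integral_sub (i1.const_mul _) (i2.const_mul _), integral_const, integral_const_mul,
    integral_const_mul, e1, e2, Matrix.nonsing_inv_mul _ (isUnit_iff_ne_zero.mpr hSd.ne')]
  simp
  ring

lemma aux_eig {ι : Type*} [Fintype ι] [DecidableEq ι] (A : Matrix ι ι ℝ) (hA : A.PosDef)
    (a s : ℝ) (ha : 0 < a) (hs : 0 ≤ s) :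
    (A⁻¹ * (a • A + s • (1 : Matrix ι ι ℝ))).trace = ∑ i, (a + s * (hA.1.eigenvalues i)⁻¹) ∧
    Real.log A.det - Real.log (a • A + s • (1 : Matrix ι ι ℝ)).det
      = - ∑ i, Real.log (a + s * (hA.1.eigenvalues i)⁻¹) := by
  set ξ := hA.1.eigenvalues with hξ
  have hpos : ∀ i, 0 < ξ i := fun i => hA.eigenvalues_pos i
  have hU := hA.1.spectral_theorem
  rw [Unitary.conjStarAlgAut_apply] at hU
  set U : Matrix ι ι ℝ := (hA.1.eigenvectorUnitary : Matrix ι ι ℝ) with hUd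
  set V : Matrix ι ι ℝ := star U with hV
  have hUV : U * V = 1 := Unitary.coe_mul_star_self hA.1.eigenvectorUnitary
  have hVU : V * U = 1 := Unitary.coe_star_mul_self hA.1.eigenvectorUnitary
  have hU' : A = U * diagonal ξ * V := by simpa using hU
  clear hU
  have hdet : A.det ≠ 0 := hA.det_pos.ne'
  have key : A * (U * diagonal (fun i => a + s * (ξ i)⁻¹) * V)
      = a • A + s • (1 : Matrix ι ι ℝ) := by
    have e1 : a • A + s • (1 : Matrix ι ι ℝ) = U * diagonal (fun i => a * ξ i + s) * V := by
      have : diagonal (fun i => a * ξ i + s) = a • diagonal ξ + s • (1 : Matrix ι ι ℝ) := by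
        rw [← Matrix.diagonal_one, ← Matrix.diagonal_smul, ← Matrix.diagonal_smul,
          Matrix.diagonal_add]
        congr 1; ext i; simp
      rw [this, Matrix.mul_add, Matrix.add_mul]
      simp [hUV, ← hU']
    rw [e1]
    have e2 : A * (U * diagonal (fun i => a + s * (ξ i)⁻¹) * V)
        = U * (diagonal ξ * ((V * U) * diagonal (fun i => a + s * (ξ i)⁻¹))) * V := by
      conv_lhs => rw [hU']
      simp only [Matrix.mul_assoc]
    rw [e2, hVU, Matrix.one_mul, Matrix.diagonal_mul_diagonal]
    congr 3
    ext i
    have := (hpos i).ne'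
    field_simp
  have hT : A⁻¹ * (a • A + s • (1 : Matrix ι ι ℝ))
      = U * diagonal (fun i => a + s * (ξ i)⁻¹) * V := by
    rw [← key, ← Matrix.mul_assoc, Matrix.nonsing_inv_mul _ (isUnit_iff_ne_zero.mpr hdet),
      Matrix.one_mul]
  have hp : ∀ i, 0 < a + s * (ξ i)⁻¹ := fun i => by have := hpos i; positivity
  constructor
  · rw [hT, Matrix.trace_mul_comm, ← Matrix.mul_assoc, hVU, Matrix.one_mul, Matrix.trace_diagonal]
  · have hd : (U * diagonal (fun i => a + s * (ξ i)⁻¹) * V).det = ∏ i, (a + s * (ξ i)⁻¹) := by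
      rw [Matrix.det_mul_comm, ← Matrix.mul_assoc, hVU, Matrix.one_mul, Matrix.det_diagonal]
    rw [← key, Matrix.det_mul, hd, Real.log_mul hdet
      (Finset.prod_ne_zero_iff.mpr fun i _ => (hp i).ne'), Real.log_prod fun i _ => (hp i).ne']
    ring

lemma aux_main {ι κ : Type*} [Fintype ι] [DecidableEq ι] [Fintype κ] [DecidableEq κ]
    (So : Matrix ι ι ℝ) (C : Matrix ι κ ℝ) (Sc : Matrix κ κ ℝ) (hSo : So.PosDef)
    (hSc : Sc.PosDef) (α s : ℝ) (hα : 0 < α) (hs : 0 ≤ s) :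
    (∫ y, KLdiv
        (gaussMeasure (α • (Cᵀ *ᵥ (So⁻¹ *ᵥ y))) (α^2 • Sc + s • (1 : Matrix κ κ ℝ)))
        (gaussMeasure (Cᵀ *ᵥ (So⁻¹ *ᵥ y)) Sc)
      ∂(gaussMeasure (0 : ι → ℝ) So)) =
      (1/2) * ((∑ i, (α^2 + s * (hSc.1.eigenvalues i)⁻¹))
        - (∑ i, Real.log (α^2 + s * (hSc.1.eigenvalues i)⁻¹))
        - (Fintype.card κ : ℝ)
        + (1 - α)^2 * (Cᵀ * So⁻¹ * C * Sc⁻¹).trace) := by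
  have hP : (α^2 • Sc + s • (1 : Matrix κ κ ℝ)).PosDef :=
    (hSc.smul (by positivity)).add_posSemidef (Matrix.PosSemidef.one.smul hs)
  obtain ⟨t1, t2⟩ := aux_eig Sc hSc (α^2) s (by positivity) hs
  have hpr := aux_prob 0 So hSo
  set N : Matrix ι ι ℝ := (Cᵀ * So⁻¹)ᵀ * (Sc⁻¹ * (Cᵀ * So⁻¹)) with hN
  have hq : ∀ y : ι → ℝ, (α • (Cᵀ *ᵥ (So⁻¹ *ᵥ y)) - Cᵀ *ᵥ (So⁻¹ *ᵥ y)) ⬝ᵥ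
      (Sc⁻¹ *ᵥ (α • (Cᵀ *ᵥ (So⁻¹ *ᵥ y)) - Cᵀ *ᵥ (So⁻¹ *ᵥ y)))
      = (1 - α)^2 * ((y - 0) ⬝ᵥ (N *ᵥ (y - 0))) := by
    intro y
    have e : α • (Cᵀ *ᵥ (So⁻¹ *ᵥ y)) - Cᵀ *ᵥ (So⁻¹ *ᵥ y) = (α - 1) • ((Cᵀ * So⁻¹) *ᵥ y) := by
      rw [sub_smul, one_smul, Matrix.mulVec_mulVec]
    rw [e, sub_zero, hN, ← Matrix.mulVec_mulVec y (Cᵀ * So⁻¹)ᵀ,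
      ← Matrix.mulVec_mulVec y Sc⁻¹,
      Matrix.dotProduct_mulVec y, Matrix.vecMul_transpose, Matrix.mulVec_smul,
      smul_dotProduct, dotProduct_smul, smul_eq_mul, smul_eq_mul]
    ring
  obtain ⟨i1, e1⟩ := aux_quad 0 0 So N hSo
  simp only [aux_KL _ _ _ _ hP hSc, hq, t1, t2]
  rw [integral_const_mul, integral_add (integrable_const _) (i1.const_mul _), integral_const_mul,
    e1]
  have ht : (N * So).trace = (Cᵀ * So⁻¹ * C * Sc⁻¹).trace := by
    have hsym : So⁻¹ᵀ = So⁻¹ := by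
      rw [← Matrix.conjTranspose_eq_transpose_of_trivial]; exact hSo.inv.1
    have hu : So⁻¹ * So = 1 := Matrix.nonsing_inv_mul _ (isUnit_iff_ne_zero.mpr hSo.det_pos.ne')
    rw [hN, Matrix.transpose_mul, hsym, Matrix.transpose_transpose]
    simp only [Matrix.mul_assoc, hu, Matrix.mul_one]
    rw [← Matrix.mul_assoc, ← Matrix.mul_assoc, Matrix.trace_mul_comm]
    simp only [Matrix.mul_assoc]
  rw [ht]
  simp
  ring

/-- expected KL divergence between the OU-diffused conditional law at the
early-stopping time `t₀` and the true conditional law, over `y ~ N(0, Σ_obs)`, with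
`α = e^{-t₀/2}`, `σ² = 1 − e^{-t₀}` and `ξ₁, …, ξ_{m₁}` the eigenvalues of `Σ_cond`:
`E_y[KL] = (1/2)[Σᵢ(α² + σ²ξᵢ⁻¹) − Σᵢ log(α² + σ²ξᵢ⁻¹) − m₁
  + (1−α)² tr(Σ_corᵀΣ_obs⁻¹Σ_cor Σ_cond⁻¹)]`. -/
theorem expected_kl_diffused_conditional
    {H d : ℕ} (hH : 2 ≤ H) (hd : 1 ≤ d)
    (Γ : Matrix (Fin H) (Fin H) ℝ) (Λ : Matrix (Fin d) (Fin d) ℝ)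
    (hΓ : Γ.PosDef) (hΛ : Λ.PosDef)
    (Iobs Imiss : Finset (Fin H)) (hobs : Iobs.Nonempty) (hmiss : Imiss.Nonempty)
    (hdisj : Disjoint Iobs Imiss) (hunion : Iobs ∪ Imiss = Finset.univ)
    (t₀ : ℝ) (ht₀ : 0 < t₀) :
    let Γobs : Matrix {i // i ∈ Iobs} {i // i ∈ Iobs} ℝ :=
      Γ.submatrix (fun i => (i : Fin H)) (fun i => (i : Fin H))
    let Γmiss : Matrix {i // i ∈ Imiss} {i // i ∈ Imiss} ℝ :=
      Γ.submatrix (fun i => (i : Fin H)) (fun i => (i : Fin H))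
    let Γcor : Matrix {i // i ∈ Iobs} {i // i ∈ Imiss} ℝ :=
      Γ.submatrix (fun i => (i : Fin H)) (fun i => (i : Fin H))
    let Sobs : Matrix ({i // i ∈ Iobs} × Fin d) ({i // i ∈ Iobs} × Fin d) ℝ := Γobs ⊗ₖ Λ
    let Smiss : Matrix ({i // i ∈ Imiss} × Fin d) ({i // i ∈ Imiss} × Fin d) ℝ := Γmiss ⊗ₖ Λ
    let Scor : Matrix ({i // i ∈ Iobs} × Fin d) ({i // i ∈ Imiss} × Fin d) ℝ := Γcor ⊗ₖ Λ
    let Scond : Matrix ({i // i ∈ Imiss} × Fin d) ({i // i ∈ Imiss} × Fin d) ℝ :=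
      Smiss - Scor.transpose * Sobs⁻¹ * Scor
    let μcond : ({i // i ∈ Iobs} × Fin d → ℝ) → ({i // i ∈ Imiss} × Fin d → ℝ) :=
      fun y => Scor.transpose *ᵥ (Sobs⁻¹ *ᵥ y)
    let α : ℝ := Real.exp (-t₀/2)
    let σ2 : ℝ := 1 - Real.exp (-t₀)
    let m₁ : ℝ := (Fintype.card ({i // i ∈ Imiss} × Fin d) : ℝ)
    ∀ hScond : Scond.PosDef,
    (∫ y, KLdiv
        (gaussMeasure (α • μcond y)
          (α^2 • Scond + σ2 •
            (1 : Matrix ({i // i ∈ Imiss} × Fin d) ({i // i ∈ Imiss} × Fin d) ℝ)))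
        (gaussMeasure (μcond y) Scond)
      ∂(gaussMeasure (0 : {i // i ∈ Iobs} × Fin d → ℝ) Sobs)) =
      (1/2) * ((∑ i, (α^2 + σ2 * (hScond.1.eigenvalues i)⁻¹))
        - (∑ i, Real.log (α^2 + σ2 * (hScond.1.eigenvalues i)⁻¹))
        - m₁
        + (1 - α)^2 * (Scor.transpose * Sobs⁻¹ * Scor * Scond⁻¹).trace) := by
  intro Γobs Γmiss Γcor Sobs Smiss Scor Scond μcond α σ2 m₁ hScond
  have hSobs : Sobs.PosDef := (hΓ.submatrix Subtype.val_injective).kronecker hΛ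
  have hσ : 0 ≤ σ2 := by
    have : Real.exp (-t₀) ≤ 1 := Real.exp_le_one_iff.mpr (by linarith)
    simp only [σ2]; linarith
  exact aux_main Sobs Scor Scond hSobs hScond α σ2 (Real.exp_pos _) hσ

end
end
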